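/- arXiv:0706.4055 — 6 statements merged into one kernel-verified Lean document; each statement's English description precedes it below -/
import Mathlib

section
/- Let ξ₁, ξ₂ ∈ ℝ \ {0} with ξ₁ + ξ₂ ≠ 0 and let μ₁, μ₂ ∈ ℝ. Then ω(ξ₁,μ₁) + ω(ξ₂,μ₂) − ω(ξ₁+ξ₂, μ₁+μ₂) = −(ξ₁ξ₂/(ξ₁+ξ₂)) · [ (√3(ξ₁+ξ₂))² − (μ₁/ξ₁ − μ₂/ξ₂)² ] = −(ξ₁ξ₂/(ξ₁+ξ₂)) · [ (√3ξ₁ − μ₁/ξ₁) + (√3ξ₂ + μ₂/ξ₂) ] · [ (√3ξ₁ + μ₁/ξ₁) + (√3ξ₂ − μ₂/ξ₂) ]. -/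
open Real

noncomputable section

/-- The KP-I dispersion relation `ω(ξ,μ) = ξ³ + μ²/ξ`. -/
def disp (ξ μ : ℝ) : ℝ := ξ ^ 3 + μ ^ 2 / ξ

theorem resonance_identity (ξ₁ ξ₂ : ℝ) (h₁ : ξ₁ ≠ 0) (h₂ : ξ₂ ≠ 0)
    (h₁₂ : ξ₁ + ξ₂ ≠ 0) (μ₁ μ₂ : ℝ) :
    disp ξ₁ μ₁ + disp ξ₂ μ₂ - disp (ξ₁ + ξ₂) (μ₁ + μ₂) =
      -(ξ₁ * ξ₂ / (ξ₁ + ξ₂)) *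
        ((Real.sqrt 3 * (ξ₁ + ξ₂)) ^ 2 - (μ₁ / ξ₁ - μ₂ / ξ₂) ^ 2) ∧
    disp ξ₁ μ₁ + disp ξ₂ μ₂ - disp (ξ₁ + ξ₂) (μ₁ + μ₂) =
      -(ξ₁ * ξ₂ / (ξ₁ + ξ₂)) *
        ((Real.sqrt 3 * ξ₁ - μ₁ / ξ₁) + (Real.sqrt 3 * ξ₂ + μ₂ / ξ₂)) *
        ((Real.sqrt 3 * ξ₁ + μ₁ / ξ₁) + (Real.sqrt 3 * ξ₂ - μ₂ / ξ₂)) := by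
  have key : disp ξ₁ μ₁ + disp ξ₂ μ₂ - disp (ξ₁ + ξ₂) (μ₁ + μ₂) =
      -(ξ₁ * ξ₂ / (ξ₁ + ξ₂)) *
        ((Real.sqrt 3 * (ξ₁ + ξ₂)) ^ 2 - (μ₁ / ξ₁ - μ₂ / ξ₂) ^ 2) := by
    rw [mul_pow, Real.sq_sqrt (by norm_num)]
    unfold disp
    field_simp
    ring
  exact ⟨key, key.trans (by ring)⟩
end
end

section
/- Let ξ₁, ξ₂ ∈ ℝ \ {0} with ξ₁ + ξ₂ ≠ 0, and let β₁, β₂ ∈ ℝ. Set μ₁ = √3·ξ₁² + β₁ξ₁ and μ₂ = −√3·ξ₂² + β₂ξ₂. Then ω(ξ₁,μ₁) + ω(ξ₂,μ₂) − ω(ξ₁+ξ₂, μ₁+μ₂) = ξ₁ξ₂(β₁−β₂)·(2√3 + (β₁−β₂)/(ξ₁+ξ₂)). -/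
open Real

noncomputable section

theorem resonance_identity_beta_coordinates (ξ₁ ξ₂ : ℝ) (h₁ : ξ₁ ≠ 0) (h₂ : ξ₂ ≠ 0)
    (h₁₂ : ξ₁ + ξ₂ ≠ 0) (β₁ β₂ : ℝ) :
    disp ξ₁ (Real.sqrt 3 * ξ₁ ^ 2 + β₁ * ξ₁) +
        disp ξ₂ (-(Real.sqrt 3) * ξ₂ ^ 2 + β₂ * ξ₂) -
        disp (ξ₁ + ξ₂)
          ((Real.sqrt 3 * ξ₁ ^ 2 + β₁ * ξ₁) + (-(Real.sqrt 3) * ξ₂ ^ 2 + β₂ * ξ₂)) =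
      ξ₁ * ξ₂ * (β₁ - β₂) * (2 * Real.sqrt 3 + (β₁ - β₂) / (ξ₁ + ξ₂)) := by
  have hs : Real.sqrt 3 ^ 2 = 3 := Real.sq_sqrt (by norm_num)
  generalize Real.sqrt 3 = s at hs ⊢
  have resonance_sub : disp ξ₁ (s * ξ₁ ^ 2 + β₁ * ξ₁) + disp ξ₂ (-s * ξ₂ ^ 2 + β₂ * ξ₂) -
        disp (ξ₁ + ξ₂) ((s * ξ₁ ^ 2 + β₁ * ξ₁) + (-s * ξ₂ ^ 2 + β₂ * ξ₂)) -
      ξ₁ * ξ₂ * (β₁ - β₂) * (2 * s + (β₁ - β₂) / (ξ₁ + ξ₂)) =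
      ξ₁ * ξ₂ * (ξ₁ + ξ₂) * (s ^ 2 - 3) := by
    unfold disp
    field_simp
    ring
  rw [hs, sub_self, mul_zero] at resonance_sub
  exact sub_eq_zero.mp resonance_sub
end
end

section
/- Let k, k₁, k₂ ∈ ℤ with k ≥ 40, k₁ ≤ 0, and k−2 ≤ k₂ ≤ k+2. If ξ₂ ∈ I_{k₂}, μ₂ ∈ [2^{2k−11}, 2^{2k+11}], ξ₁ ∈ I_{k₁}, and |μ₁| ≤ 2^{k+2k₁−9}, then |Ω((ξ₁,μ₁),(ξ₂,μ₂))| ≥ 2^{k+k₁−4} · |(√3ξ₁ + μ₁/ξ₁) + (√3ξ₂ − μ₂/ξ₂)| (note ξ₁ + ξ₂ ≠ 0 under these hypotheses, so Ω is defined). -/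
open Real Set

noncomputable section

/-- The dyadic frequency shell `I_k = {ξ : 2^(k-1) ≤ |ξ| ≤ 2^(k+1)}`. -/
def Ik (k : ℤ) : Set ℝ := {ξ : ℝ | (2:ℝ) ^ (k - 1) ≤ |ξ| ∧ |ξ| ≤ (2:ℝ) ^ (k + 1)}

/-- The resonance function `Ω((ξ₁,μ₁),(ξ₂,μ₂)) = ω(ξ₁,μ₁) + ω(ξ₂,μ₂) − ω(ξ₁+ξ₂,μ₁+μ₂)`. -/
def reson (ξ₁ μ₁ ξ₂ μ₂ : ℝ) : ℝ := disp ξ₁ μ₁ + disp ξ₂ μ₂ - disp (ξ₁ + ξ₂) (μ₁ + μ₂)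

/-- The resonance function factors as a product of two quantities that are linear in the
slopes `μᵢ / ξᵢ`. -/
lemma reson_eq_mul {ξ₁ ξ₂ : ℝ} (μ₁ μ₂ : ℝ) (h₁ : ξ₁ ≠ 0) (h₂ : ξ₂ ≠ 0) (hs : ξ₁ + ξ₂ ≠ 0) :
    reson ξ₁ μ₁ ξ₂ μ₂ = ξ₁ * ξ₂ / (ξ₁ + ξ₂) *
      ((μ₁ / ξ₁ - √3 * ξ₁) - (√3 * ξ₂ + μ₂ / ξ₂)) *
      ((√3 * ξ₁ + μ₁ / ξ₁) + (√3 * ξ₂ - μ₂ / ξ₂)) := by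
  have h3 : √3 ^ 2 = (3 : ℝ) := Real.sq_sqrt (by norm_num)
  have key : ((μ₁ / ξ₁ - √3 * ξ₁) - (√3 * ξ₂ + μ₂ / ξ₂)) *
      ((√3 * ξ₁ + μ₁ / ξ₁) + (√3 * ξ₂ - μ₂ / ξ₂)) =
      (μ₁ / ξ₁ - μ₂ / ξ₂) ^ 2 - 3 * (ξ₁ + ξ₂) ^ 2 := by
    linear_combination (-(ξ₁ + ξ₂) ^ 2) * h3
  rw [mul_assoc, key]
  unfold reson disp
  field_simp
  ring

/-- If `μ ≥ 0`, adding `μ / ξ` to `c * ξ` does not bring its size below `c * |ξ|`. -/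
lemma mul_abs_le_abs_mul_add_div {ξ μ : ℝ} (c : ℝ) (hμ : 0 ≤ μ) :
    c * |ξ| ≤ |c * ξ + μ / ξ| := by
  rcases le_total 0 ξ with h | h
  · rw [abs_of_nonneg h]
    exact (le_add_of_nonneg_right (div_nonneg hμ h)).trans (le_abs_self _)
  · rw [abs_of_nonpos h]
    have := div_nonpos_of_nonneg_of_nonpos hμ h
    linarith [neg_le_abs (c * ξ + μ / ξ)]

theorem resonance_lower_bound (k k₁ k₂ : ℤ) (hk : 40 ≤ k) (hk₁ : k₁ ≤ 0)
    (hk₂ : k - 2 ≤ k₂) (hk₂' : k₂ ≤ k + 2) (ξ₁ ξ₂ μ₁ μ₂ : ℝ)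
    (hξ₂ : ξ₂ ∈ Ik k₂) (hμ₂ : μ₂ ∈ Icc ((2:ℝ) ^ (2*k - 11)) ((2:ℝ) ^ (2*k + 11)))
    (hξ₁ : ξ₁ ∈ Ik k₁) (hμ₁ : |μ₁| ≤ (2:ℝ) ^ (k + 2*k₁ - 9)) :
    (2:ℝ) ^ (k + k₁ - 4) *
        |(Real.sqrt 3 * ξ₁ + μ₁ / ξ₁) + (Real.sqrt 3 * ξ₂ - μ₂ / ξ₂)| ≤
      |reson ξ₁ μ₁ ξ₂ μ₂| := by
  obtain ⟨ha, ha'⟩ := hξ₁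
  have hb := hξ₂.1
  have hμ₂0 : 0 ≤ μ₂ := le_trans (by positivity) hμ₂.1
  have hbX : (2:ℝ) ^ (k - 3) ≤ |ξ₂| :=
    (zpow_le_zpow_right₀ (by norm_num) (by linarith)).trans hb
  have hX : (2:ℝ) ^ (40:ℤ) ≤ 2 ^ k := zpow_le_zpow_right₀ (by norm_num) hk
  have hY : (2:ℝ) ^ k₁ ≤ 1 := zpow_le_one_of_nonpos₀ (by norm_num) hk₁
  have hX0 : (0:ℝ) < 2 ^ k := by positivity
  have hY0 : (0:ℝ) < 2 ^ k₁ := by positivity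
  have e1 : (2:ℝ) ^ (k + k₁ - 4) = 2 ^ k * 2 ^ k₁ / 16 := by
    rw [zpow_sub₀ two_ne_zero, zpow_add₀ two_ne_zero]; norm_num
  have e2 : (2:ℝ) ^ (k + 2 * k₁ - 9) = 2 ^ k * (2 ^ k₁ * 2 ^ k₁) / 512 := by
    rw [zpow_sub₀ two_ne_zero, zpow_add₀ two_ne_zero, two_mul, zpow_add₀ two_ne_zero]; norm_num
  rw [zpow_sub₀ two_ne_zero] at ha hbX
  rw [zpow_add₀ two_ne_zero] at ha'
  rw [e2] at hμ₁
  rw [e1]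
  generalize (2:ℝ) ^ k = X at *
  generalize (2:ℝ) ^ k₁ = Y at *
  norm_num at ha ha' hbX hX
  have ha0 : 0 < |ξ₁| := by linarith
  have hb0 : 0 < |ξ₂| := by linarith
  have hs : |ξ₁ + ξ₂| ≤ |ξ₁| + |ξ₂| := abs_add_le _ _
  have hs' : |ξ₂| - |ξ₁| ≤ |ξ₁ + ξ₂| := by
    simpa [add_comm] using abs_sub_abs_le_abs_sub ξ₂ (-ξ₁)
  have hs0 : 0 < |ξ₁ + ξ₂| := by linarith
  have hsqrt : (1.7:ℝ) ≤ √3 := Real.le_sqrt_of_sq_le (by norm_num)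
  have hsqrt' : √3 ≤ 2 := Real.sqrt_le_iff.2 (by norm_num)
  have hslope : |μ₁ / ξ₁| ≤ X / 256 := by
    rw [abs_div, div_le_iff₀ ha0]
    have : X * (Y * Y) ≤ X * Y := mul_le_mul_of_nonneg_left (by nlinarith) hX0.le
    nlinarith
  have hsmall : |μ₁ / ξ₁ - √3 * ξ₁| ≤ X / 256 + 4 := by
    refine (abs_sub _ _).trans (add_le_add hslope ?_)
    rw [abs_mul, abs_of_nonneg (Real.sqrt_nonneg 3)]
    nlinarith
  have hlarge : 1.7 * |ξ₂| ≤ |√3 * ξ₂ + μ₂ / ξ₂| :=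
    (mul_le_mul_of_nonneg_right hsqrt hb0.le).trans
      (mul_abs_le_abs_mul_add_div _ hμ₂0)
  have hD : 1.6 * |ξ₂| ≤ |(μ₁ / ξ₁ - √3 * ξ₁) - (√3 * ξ₂ + μ₂ / ξ₂)| := by
    have := abs_sub_abs_le_abs_sub (√3 * ξ₂ + μ₂ / ξ₂) (μ₁ / ξ₁ - √3 * ξ₁)
    rw [abs_sub_comm (√3 * ξ₂ + μ₂ / ξ₂)] at this
    linarith
  rw [reson_eq_mul μ₁ μ₂ (abs_pos.1 ha0) (abs_pos.1 hb0) (abs_pos.1 hs0), abs_mul, abs_mul,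
    abs_div, abs_mul]
  refine mul_le_mul_of_nonneg_right ?_ (abs_nonneg _)
  rw [div_mul_eq_mul_div, le_div_iff₀ hs0]
  calc X * Y / 16 * |ξ₁ + ξ₂| ≤ X * Y / 16 * (1.6 * |ξ₂|) := by
        gcongr
        linarith
    _ = (Y / 2) * (X / 8) * (1.6 * |ξ₂|) := by ring
    _ ≤ |ξ₁| * |ξ₂| * |(μ₁ / ξ₁ - √3 * ξ₁) - (√3 * ξ₂ + μ₂ / ξ₂)| := by
        gcongr
end
end

section
/- Let ψ : ℝ → [0,1] be a smooth function supported in [−2,2] and equal to 1 on [−1,1]. For N > 0 define F_N, G : ℝ³ → [0,∞) by F_N(ξ,μ,τ) = ψ(ξ−N)·ψ((μ−√3ξ²)/ξ)·ψ(τ−ω(ξ,μ)) for ξ ≠ 0 (and 0 for ξ = 0), and G(ξ,μ,τ) = ψ(ξ−4)·ψ((μ+√3ξ²)/ξ)·ψ(τ−ω(ξ,μ)) for ξ ≠ 0 (and 0 for ξ = 0). Then there exist c > 0 and N₀ ≥ 1, depending only on ψ, such that for all N ≥ N₀ and all j ∈ ℤ with 100 ≤ 2^j ≤ N^{1/10},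 ∫_{ℝ³} (F_N ∗ G)(ξ,μ,τ) · 𝟏_{[N−10, N+10]}(ξ) · 𝟏_{[√3N²−100N, √3N²+100N]}(μ) · 𝟏_{{2^{j−1} ≤ |τ−ω(ξ,μ)| ≤ 2^{j+1}}}(ξ,μ,τ) dξ dμ dτ ≥ c·2^j, where ∗ denotes convolution on ℝ³ and 𝟏_A is the indicator function of the set A. -/
open MeasureTheory Real Set

noncomputable section

/-- Convolution on `ℝ³`. -/
def conv3 (f g : ℝ × ℝ × ℝ → ℝ) : ℝ × ℝ × ℝ → ℝ := fun p => ∫ q, f q * g (p - q)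

/-- The function `F_N(ξ,μ,τ) = ψ(ξ−N)·ψ((μ−√3ξ²)/ξ)·ψ(τ−ω(ξ,μ))` for `ξ ≠ 0`, `0` for `ξ = 0`. -/
def FN (ψ : ℝ → ℝ) (N : ℝ) : ℝ × ℝ × ℝ → ℝ := fun p =>
  if p.1 = 0 then 0 else
    ψ (p.1 - N) * ψ ((p.2.1 - Real.sqrt 3 * p.1 ^ 2) / p.1) * ψ (p.2.2 - disp p.1 p.2.1)

/-- The function `G(ξ,μ,τ) = ψ(ξ−4)·ψ((μ+√3ξ²)/ξ)·ψ(τ−ω(ξ,μ))` for `ξ ≠ 0`, `0` for `ξ = 0`. -/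
def Gfun (ψ : ℝ → ℝ) : ℝ × ℝ × ℝ → ℝ := fun p =>
  if p.1 = 0 then 0 else
    ψ (p.1 - 4) * ψ ((p.2.1 + Real.sqrt 3 * p.1 ^ 2) / p.1) * ψ (p.2.2 - disp p.1 p.2.1)

instance isAddHaarMeasure_volume_prod_prod :
    (volume : Measure (ℝ × ℝ × ℝ)).IsAddHaarMeasure :=
  Measure.prod.instIsAddHaarMeasure _ _

theorem mul_le_measure_prod {α β : Type*} [MeasurableSpace α] [MeasurableSpace β]
    (μ : Measure α) (ν : Measure β) [SFinite ν] {s : Set (α × β)} {A : Set α}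
    (hA : MeasurableSet A) {c : ENNReal} (h : ∀ x ∈ A, c ≤ ν (Prod.mk x ⁻¹' s)) :
    μ A * c ≤ μ.prod ν s := by
  rw [← measure_toMeasurable s, Measure.prod_apply (measurableSet_toMeasurable _ _)]
  calc μ A * c = ∫⁻ _ in A, c ∂μ := by rw [setLIntegral_const, mul_comm]
    _ ≤ ∫⁻ x in A, ν (Prod.mk x ⁻¹' toMeasurable (μ.prod ν) s) ∂μ :=
        setLIntegral_mono' hA fun x hx =>
          (h x hx).trans (measure_mono (preimage_mono (subset_toMeasurable _ _)))
    _ ≤ _ := setLIntegral_le_lintegral _ _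

theorem mul_le_integral_of_le_on_box {f : ℝ × ℝ × ℝ → ℝ} (hf : Integrable f) (hf0 : 0 ≤ f)
    {ε a k l m : ℝ} (hε : 0 ≤ ε) (hk : 0 ≤ k) (hl : 0 ≤ l)
    (h : ∀ x ∈ Icc a (a + k), ∃ y₀, ∀ y ∈ Icc y₀ (y₀ + l), ∃ t₀, ∀ t ∈ Icc t₀ (t₀ + m),
      ε ≤ f (x, y, t)) :
    ε * (k * (l * m)) ≤ ∫ p, f p := by
  rcases hε.eq_or_lt with rfl | hε
  · simpa using integral_nonneg hf0
  refine le_trans ?_ (mul_meas_ge_le_integral_of_nonneg (.of_forall hf0) hf ε)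
  refine mul_le_mul_of_nonneg_left ?_ hε.le
  refine (ENNReal.ofReal_le_iff_le_toReal (hf.measure_ge_lt_top hε).ne).1 ?_
  rw [ENNReal.ofReal_mul hk, ENNReal.ofReal_mul hl]
  have hvol : ∀ c r : ℝ, ENNReal.ofReal r = volume (Icc c (c + r)) := by
    intro c r
    simp
  rw [hvol a k]
  refine mul_le_measure_prod volume volume measurableSet_Icc fun x hx => ?_
  obtain ⟨y₀, hy₀⟩ := h x hx
  rw [hvol y₀ l]
  refine mul_le_measure_prod volume volume measurableSet_Icc fun y hy => ?_
  obtain ⟨t₀, ht₀⟩ := hy₀ y hy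
  rw [hvol t₀ m]
  exact measure_mono fun t ht => ht₀ t ht

theorem disp_resonance {x z u v : ℝ} (hx : 0 < x) (hz : 0 < z) :
    disp x (√3 * x ^ 2 + u * x) + disp z (-√3 * z ^ 2 + v * z)
      - disp (x + z) ((√3 * x ^ 2 + u * x) + (-√3 * z ^ 2 + v * z)) =
    x * z * (2 * √3 * (u - v) + (u - v) ^ 2 / (x + z)) := by
  have h3 : √3 ^ 2 = 3 := Real.sq_sqrt (by norm_num)
  have hxz : x + z ≠ 0 := by positivity
  unfold disp
  field_simp
  linear_combination (x * z * (x + z) ^ 2) * h3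

theorem measurable_disp : Measurable fun p : ℝ × ℝ × ℝ => disp p.1 p.2.1 := by
  unfold disp
  fun_prop

theorem integrable_cutoff {ψ : ℝ → ℝ} (hψ : Measurable ψ) (hrange : ∀ s, ψ s ∈ Icc (0:ℝ) 1)
    (hsupp : Function.support ψ ⊆ Icc (-2 : ℝ) 2) {a b : ℝ} (ha : 3 ≤ a) :
    Integrable fun p : ℝ × ℝ × ℝ => if p.1 = 0 then 0 else
      ψ (p.1 - a) * ψ ((p.2.1 + b * p.1 ^ 2) / p.1) * ψ (p.2.2 - disp p.1 p.2.1) := by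
  have hmeas : Measurable fun p : ℝ × ℝ × ℝ => if p.1 = 0 then 0 else
      ψ (p.1 - a) * ψ ((p.2.1 + b * p.1 ^ 2) / p.1) * ψ (p.2.2 - disp p.1 p.2.1) := by
    have := measurable_disp
    refine Measurable.ite (measurable_fst (measurableSet_singleton 0)) measurable_const ?_
    fun_prop
  set M : ℝ := |b| * (a + 2) ^ 2 + 2 * (a + 2) with hM
  set T : ℝ := (a + 2) ^ 3 + M ^ 2 + 2 with hT
  set K : Set (ℝ × ℝ × ℝ) := Icc (a - 2) (a + 2) ×ˢ Icc (-M) M ×ˢ Icc (-T) T with hK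
  have hKc : IsCompact K := isCompact_Icc.prod (isCompact_Icc.prod isCompact_Icc)
  refine (IntegrableOn.integrable_of_forall_notMem_eq_zero (s := K) ?_ ?_)
  · refine Measure.integrableOn_of_bounded (M := 1) hKc.measure_lt_top.ne
      hmeas.aestronglyMeasurable (.of_forall fun p => ?_)
    have h1 := hrange (p.1 - a)
    have h2 := hrange ((p.2.1 + b * p.1 ^ 2) / p.1)
    have h3 := hrange (p.2.2 - disp p.1 p.2.1)
    split_ifs
    · simp
    · rw [Real.norm_eq_abs, abs_of_nonneg (mul_nonneg (mul_nonneg h1.1 h2.1) h3.1)]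
      exact mul_le_one₀ (mul_le_one₀ h1.2 h2.1 h2.2) h3.1 h3.2
  · rintro ⟨x, y, t⟩ hp
    by_contra hne
    apply hp
    simp only [ite_eq_left_iff, mul_eq_zero, not_forall, not_or] at hne
    obtain ⟨hx0, ⟨h1, h2⟩, h3⟩ := hne
    obtain ⟨h1l, h1r⟩ := hsupp h1
    obtain ⟨h2l, h2r⟩ := hsupp h2
    obtain ⟨h3l, h3r⟩ := hsupp h3
    have hx1 : 1 ≤ x := by linarith
    have hxp : 0 < x := by linarith
    have hxa : x ≤ a + 2 := by linarith
    rw [le_div_iff₀ hxp] at h2l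
    rw [div_le_iff₀ hxp] at h2r
    have hb : |b * x ^ 2| ≤ |b| * (a + 2) ^ 2 := by
      rw [abs_mul, abs_of_nonneg (sq_nonneg x)]
      gcongr
    have hb' := abs_le.1 hb
    have hyM : |y| ≤ M := by
      rw [abs_le, hM]
      constructor <;> linarith [hb'.1, hb'.2]
    have hd : |disp x y| ≤ (a + 2) ^ 3 + M ^ 2 := by
      unfold disp
      rw [abs_of_nonneg (by positivity), ← sq_abs y]
      refine add_le_add (by gcongr) ?_
      exact (div_le_self (by positivity) hx1).trans (by gcongr)
    have hd' := abs_le.1 hd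
    refine ⟨⟨by linarith, by linarith⟩, abs_le.1 hyM, ?_, ?_⟩ <;>
    · simp only [hT]
      linarith [hd'.1, hd'.2]

theorem resonant_point_bounds {N ξ x m h e : ℝ} (hN : 1000 ≤ N)
    (hξ : ξ ∈ Icc (N + 4 - 1 / 20) (N + 4 + 1 / 20)) (hx : x ∈ Icc (N - 1 / 20) (N + 1 / 20))
    (hm : m ∈ Icc 0 (N / 10)) (hh : h ∈ Icc 0 N) (he : e ∈ Icc 0 (1 / (100 * N))) :
    ∃ u ∈ Icc (-1 : ℝ) 1, ∃ v ∈ Icc (-1 : ℝ) 1, ∃ R ∈ Icc h (h + 1 / 2),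
      x * (ξ - x) / ξ * (h / (2 * √3 * x * (ξ - x)) + √3 * ξ
        + (√3 * ξ * (ξ - 8) + m) / (ξ - x)) + e = √3 * x ^ 2 + u * x ∧
      √3 * ξ * (ξ - 8) + m - (√3 * x ^ 2 + u * x) = -√3 * (ξ - x) ^ 2 + v * (ξ - x) ∧
      R = x * (ξ - x) * (2 * √3 * (u - v) + (u - v) ^ 2 / (x + (ξ - x))) := by
  obtain ⟨z, rfl⟩ : ∃ z, ξ = x + z := ⟨ξ - x, by ring⟩
  simp only [add_sub_cancel_left]
  obtain ⟨hξl, hξr⟩ := hξ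
  obtain ⟨hxl, hxr⟩ := hx
  have hzl : 39 / 10 ≤ z := by linarith
  have hzr : z ≤ 41 / 10 := by linarith
  have hx0 : 0 < x := by linarith
  have hz0 : 0 < z := by linarith
  have hN0 : 0 < N := by linarith
  have hξ0 : 0 < x + z := by linarith
  have h3 : √3 ^ 2 = 3 := Real.sq_sqrt (by norm_num)
  have h3l : 17 / 10 ≤ √3 := Real.le_sqrt_of_sq_le (by norm_num)
  have h3r : √3 ≤ 18 / 10 := Real.sqrt_le_iff.2 (by norm_num)
  have h30 : 0 < √3 := by linarith
  set δ₀ := h / (2 * √3 * x * z) with hδ₀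
  set d := e * (x + z) / (x * z) with hd
  clear_value δ₀ d
  have hxz : 3 * N ≤ x * z := by nlinarith
  have hxz' : x * z ≤ 5 * N := by nlinarith
  have hxz0 : 0 < x * z := by positivity
  have hδ₀0 : 0 ≤ δ₀ := by
    rw [hδ₀]
    exact div_nonneg hh.1 (by positivity)
  have hδ₀1 : δ₀ ≤ 1 / 10 := by
    rw [hδ₀, div_le_iff₀ (by positivity)]
    have := mul_le_mul h3l hxz (by positivity) h30.le
    nlinarith [hh.2]
  have hd0 : 0 ≤ d := by
    rw [hd]
    exact div_nonneg (mul_nonneg he.1 hξ0.le) hxz0.le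
  have hde : d ≤ 1 / (100 * N) := by
    refine le_trans ?_ he.2
    rw [hd, div_le_iff₀ hxz0]
    exact mul_le_mul_of_nonneg_left (by nlinarith) he.1
  have hNd : N * d ≤ 1 / 100 := by
    rw [le_div_iff₀ (by positivity)] at hde
    linarith
  have hd1 : d ≤ 1 / 100 := by nlinarith
  have hδ0 : 0 ≤ δ₀ + d := by positivity
  have hδ1 : δ₀ + d ≤ 11 / 100 := by linarith
  have hzδ : z * (δ₀ + d) / (x + z) ≤ 1 / 100 := by
    rw [div_le_iff₀ hξ0]
    nlinarith
  have hzδ0 : 0 ≤ z * (δ₀ + d) / (x + z) := by positivity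
  have hmξ0 : 0 ≤ m / (x + z) := div_nonneg hm.1 hξ0.le
  have hmξ : m / (x + z) ≤ 1 / 10 := by
    rw [div_le_iff₀ hξ0]
    linarith [hm.2]
  have h3zl : -(4 / 10) ≤ √3 * (2 * z - 8) := by nlinarith
  have h3zr : √3 * (2 * z - 8) ≤ 4 / 10 := by nlinarith
  have hmain : x * z * (2 * √3 * δ₀) = h := by
    rw [hδ₀]
    field_simp
  refine ⟨z * (δ₀ + d) / (x + z) + √3 * (2 * z - 8) + m / (x + z), ⟨by linarith, by linarith⟩,
    z * (δ₀ + d) / (x + z) + √3 * (2 * z - 8) + m / (x + z) - (δ₀ + d),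
    ⟨by linarith, by linarith⟩, _, ?_, ?_, ?_, rfl⟩
  · rw [sub_sub_cancel]
    have hsplit : x * z * (2 * √3 * (δ₀ + d) + (δ₀ + d) ^ 2 / (x + z)) =
        h + (2 * √3 * (x * z * d) + (δ₀ + d) ^ 2 * (x * z / (x + z))) := by
      rw [← hmain]
      ring
    have hfrac : x * z / (x + z) ≤ z := by
      rw [div_le_iff₀ hξ0]
      nlinarith
    have hfrac0 : 0 ≤ x * z / (x + z) := by positivity
    have hxzd : x * z * d ≤ 1 / 20 := by nlinarith
    have hxzd0 : 0 ≤ x * z * d := by positivity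
    have hA : 2 * √3 * (x * z * d) ≤ 2 * (18 / 10) * (1 / 20) := by gcongr
    have hB : (δ₀ + d) ^ 2 * (x * z / (x + z)) ≤ (11 / 100) ^ 2 * (41 / 10) := by
      exact mul_le_mul (by gcongr) (hfrac.trans hzr) hfrac0 (by positivity)
    rw [hsplit]
    constructor
    · exact le_add_of_nonneg_right (add_nonneg (mul_nonneg (by positivity) hxzd0)
        (mul_nonneg (sq_nonneg _) hfrac0))
    · exact add_le_add_right ((add_le_add hA hB).trans (by norm_num)) h
  · have hxd : x * z / (x + z) * d = e := by
      rw [hd]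
      field_simp
    rw [← hxd]
    field_simp
    ring
  · field_simp
    ring

theorem integrable_FN {ψ : ℝ → ℝ} (hψ : Measurable ψ) (hrange : ∀ s, ψ s ∈ Icc (0:ℝ) 1)
    (hsupp : Function.support ψ ⊆ Icc (-2 : ℝ) 2) {N : ℝ} (hN : 3 ≤ N) :
    Integrable (FN ψ N) := by
  unfold FN
  simpa only [neg_mul, ← sub_eq_add_neg] using
    integrable_cutoff hψ hrange hsupp (b := -√3) hN

theorem integrable_Gfun {ψ : ℝ → ℝ} (hψ : Measurable ψ) (hrange : ∀ s, ψ s ∈ Icc (0:ℝ) 1)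
    (hsupp : Function.support ψ ⊆ Icc (-2 : ℝ) 2) : Integrable (Gfun ψ) :=
  integrable_cutoff hψ hrange hsupp (b := √3) (by norm_num)

theorem FN_mem_Icc {ψ : ℝ → ℝ} (hrange : ∀ s, ψ s ∈ Icc (0:ℝ) 1) (N : ℝ) (p : ℝ × ℝ × ℝ) :
    FN ψ N p ∈ Icc (0:ℝ) 1 := by
  unfold FN
  split_ifs
  · simp
  · exact unitInterval.mul_mem (unitInterval.mul_mem (hrange _) (hrange _)) (hrange _)

theorem Gfun_mem_Icc {ψ : ℝ → ℝ} (hrange : ∀ s, ψ s ∈ Icc (0:ℝ) 1) (p : ℝ × ℝ × ℝ) :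
    Gfun ψ p ∈ Icc (0:ℝ) 1 := by
  unfold Gfun
  split_ifs
  · simp
  · exact unitInterval.mul_mem (unitInterval.mul_mem (hrange _) (hrange _)) (hrange _)

theorem FN_eq_one {ψ : ℝ → ℝ} (hone : ∀ s ∈ Icc (-1 : ℝ) 1, ψ s = 1) {N x y t u : ℝ} (hx : 0 < x)
    (hxN : x - N ∈ Icc (-1 : ℝ) 1) (hu : u ∈ Icc (-1 : ℝ) 1) (hy : y = √3 * x ^ 2 + u * x)
    (ht : t - disp x y ∈ Icc (-1 : ℝ) 1) : FN ψ N (x, y, t) = 1 := by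
  have hu' : (y - √3 * x ^ 2) / x = u := by
    rw [hy]
    field_simp
    ring
  simp [FN, hx.ne', hu', hone _ hxN, hone _ hu, hone _ ht]

theorem Gfun_eq_one {ψ : ℝ → ℝ} (hone : ∀ s ∈ Icc (-1 : ℝ) 1, ψ s = 1) {x y t v : ℝ} (hx : 0 < x)
    (hx4 : x - 4 ∈ Icc (-1 : ℝ) 1) (hv : v ∈ Icc (-1 : ℝ) 1) (hy : y = -√3 * x ^ 2 + v * x)
    (ht : t - disp x y ∈ Icc (-1 : ℝ) 1) : Gfun ψ (x, y, t) = 1 := by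
  have hv' : (y + √3 * x ^ 2) / x = v := by
    rw [hy]
    field_simp
    ring
  simp [Gfun, hx.ne', hv', hone _ hx4, hone _ hv, hone _ ht]

theorem conv3_lower_bound {ψ : ℝ → ℝ} (hψ : Measurable ψ) (hrange : ∀ s, ψ s ∈ Icc (0:ℝ) 1)
    (hsupp : Function.support ψ ⊆ Icc (-2 : ℝ) 2) (hone : ∀ s ∈ Icc (-1 : ℝ) 1, ψ s = 1)
    {N ξ m τ : ℝ} (hN : 1000 ≤ N) (hξ : ξ ∈ Icc (N + 4 - 1 / 20) (N + 4 + 1 / 20))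
    (hm : m ∈ Icc 0 (N / 10)) (hτ : τ - disp ξ (√3 * ξ * (ξ - 8) + m) ∈ Icc 0 N) :
    1 / (2000 * N) ≤ conv3 (FN ψ N) (Gfun ψ) (ξ, √3 * ξ * (ξ - 8) + m, τ) := by
  have hN0 : 0 < N := by linarith
  have hF := integrable_FN hψ hrange hsupp (N := N) (by linarith)
  have hG := integrable_Gfun hψ hrange hsupp
  have hint : Integrable fun q => FN ψ N q * Gfun ψ ((ξ, √3 * ξ * (ξ - 8) + m, τ) - q) := by
    refine hF.mul_bdd (c := 1) (hG.comp_sub_left _).aestronglyMeasurable (.of_forall fun q => ?_)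
    have := Gfun_mem_Icc hrange ((ξ, √3 * ξ * (ξ - 8) + m, τ) - q)
    rw [Real.norm_eq_abs, abs_of_nonneg this.1]
    exact this.2
  refine le_trans ?_ (mul_le_integral_of_le_on_box hint
    (fun q => mul_nonneg (FN_mem_Icc hrange N q).1 (Gfun_mem_Icc hrange _).1)
    (ε := 1) (a := N - 1 / 20) (k := 1 / 10) (l := 1 / (100 * N)) (m := 1 / 2)
    (by norm_num) (by norm_num) (by positivity) ?_)
  · apply le_of_eq
    field_simp
    norm_num
  intro x hx
  have hx' : x ∈ Icc (N - 1 / 20) (N + 1 / 20) := ⟨hx.1, by linarith [hx.2]⟩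
  set h := τ - disp ξ (√3 * ξ * (ξ - 8) + m) with hh
  refine ⟨x * (ξ - x) / ξ * (h / (2 * √3 * x * (ξ - x)) + √3 * ξ
        + (√3 * ξ * (ξ - 8) + m) / (ξ - x)), fun y hy => ⟨disp x y, fun t ht => ?_⟩⟩
  obtain ⟨u, hu, v, hv, R, hR, hyu, hyv, hRuv⟩ := resonant_point_bounds hN hξ hx' hm hτ
    (e := y - x * (ξ - x) / ξ * (h / (2 * √3 * x * (ξ - x)) + √3 * ξ
        + (√3 * ξ * (ξ - 8) + m) / (ξ - x))) ⟨by linarith [hy.1], by linarith [hy.2]⟩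
  rw [add_sub_cancel] at hyu
  rw [← hyu] at hyv
  have hx0 : 0 < x := by linarith [hx'.1]
  have hz0 : 0 < ξ - x := by linarith [hx'.2, hξ.1]
  have hres := disp_resonance (u := u) (v := v) hx0 hz0
  rw [← hyu, ← hyv, ← hRuv, add_sub_cancel, add_sub_cancel] at hres
  rw [FN_eq_one hone hx0 ⟨by linarith [hx'.1], by linarith [hx'.2]⟩ hu hyu
    ⟨by linarith [ht.1], by linarith [ht.2]⟩, one_mul]
  refine (Gfun_eq_one hone hz0 ⟨by linarith [hx'.2, hξ.1], by linarith [hx'.1, hξ.2]⟩ hv hyv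
    ⟨?_, ?_⟩).ge
  · simp only
    linarith [ht.2, hR.2]
  · simp only
    linarith [ht.1, hR.1]

theorem integrable_conv3 {f g : ℝ × ℝ × ℝ → ℝ} (hf : Integrable f) (hg : Integrable g) :
    Integrable (conv3 f g) :=
  hf.integrable_convolution (ContinuousLinearMap.mul ℝ ℝ) hg

theorem counterexample_integral_lower_bound (ψ : ℝ → ℝ)
    (hsmooth : ContDiff ℝ (⊤ : ℕ∞) ψ) (hrange : ∀ s, ψ s ∈ Icc (0:ℝ) 1)
    (hsupp : Function.support ψ ⊆ Icc (-2 : ℝ) 2)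
    (hone : ∀ s ∈ Icc (-1 : ℝ) 1, ψ s = 1) :
    ∃ c : ℝ, 0 < c ∧ ∃ N₀ : ℝ, 1 ≤ N₀ ∧ ∀ N : ℝ, N₀ ≤ N → ∀ j : ℤ,
      (100 : ℝ) ≤ (2:ℝ) ^ j → (2:ℝ) ^ j ≤ N ^ (1/10 : ℝ) →
      c * (2:ℝ) ^ j ≤
        ∫ p : ℝ × ℝ × ℝ,
          conv3 (FN ψ N) (Gfun ψ) p *
            (Icc (N - 10) (N + 10)).indicator 1 p.1 *
            (Icc (Real.sqrt 3 * N ^ 2 - 100 * N) (Real.sqrt 3 * N ^ 2 + 100 * N)).indicator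
              1 p.2.1 *
            ({q : ℝ × ℝ × ℝ | (2:ℝ) ^ (j - 1) ≤ |q.2.2 - disp q.1 q.2.1| ∧
                |q.2.2 - disp q.1 q.2.1| ≤ (2:ℝ) ^ (j + 1)}).indicator 1 p := by
  have hψ : Measurable ψ := hsmooth.continuous.measurable
  refine ⟨1 / 400000, by norm_num, 1000, by norm_num, fun N hN j hj1 hj2 => ?_⟩
  have hN0 : 0 < N := by linarith
  have hjN : (2:ℝ) ^ j ≤ N := by
    refine hj2.trans ((Real.rpow_le_rpow_of_exponent_le (by linarith)
      (by norm_num : (1 / 10 : ℝ) ≤ 1)).trans_eq (Real.rpow_one N))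
  have hjm : (2:ℝ) ^ (j - 1) = 2 ^ j / 2 := zpow_sub_one₀ two_ne_zero j
  have hjp : (2:ℝ) ^ (j + 1) = 2 ^ j * 2 := zpow_add_one₀ two_ne_zero j
  rw [hjm, hjp]
  set D : ℝ := 2 ^ j
  have hconv0 (p : ℝ × ℝ × ℝ) : 0 ≤ conv3 (FN ψ N) (Gfun ψ) p := integral_nonneg fun q =>
    mul_nonneg (FN_mem_Icc hrange N q).1 (Gfun_mem_Icc hrange _).1
  set A : Set (ℝ × ℝ × ℝ) := {p | p.1 ∈ Icc (N - 10) (N + 10) ∧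
    p.2.1 ∈ Icc (√3 * N ^ 2 - 100 * N) (√3 * N ^ 2 + 100 * N) ∧
    D / 2 ≤ |p.2.2 - disp p.1 p.2.1| ∧ |p.2.2 - disp p.1 p.2.1| ≤ D * 2} with hA
  have hAm : MeasurableSet A := by
    have := measurable_disp
    have hd : Measurable fun p : ℝ × ℝ × ℝ => |p.2.2 - disp p.1 p.2.1| := by fun_prop
    exact (measurable_fst measurableSet_Icc).inter
      ((measurable_snd.fst measurableSet_Icc).inter (hd measurableSet_Icc))
  have hAeq : ∀ p : ℝ × ℝ × ℝ, conv3 (FN ψ N) (Gfun ψ) p *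
      (Icc (N - 10) (N + 10)).indicator 1 p.1 *
      (Icc (√3 * N ^ 2 - 100 * N) (√3 * N ^ 2 + 100 * N)).indicator 1 p.2.1 *
      ({q : ℝ × ℝ × ℝ | D / 2 ≤ |q.2.2 - disp q.1 q.2.1| ∧
        |q.2.2 - disp q.1 q.2.1| ≤ D * 2}).indicator 1 p =
      A.indicator (conv3 (FN ψ N) (Gfun ψ)) p := by
    intro p
    simp only [hA, indicator_apply, mem_ofPred_eq, Pi.one_apply, mul_ite, mul_one, mul_zero,
      ← ite_and]
    congr 1
    exact propext (by tauto)
  simp_rw [hAeq]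
  have hint : Integrable (A.indicator (conv3 (FN ψ N) (Gfun ψ))) :=
    (integrable_conv3 (integrable_FN hψ hrange hsupp (by linarith))
      (integrable_Gfun hψ hrange hsupp)).indicator hAm
  refine le_trans ?_ (mul_le_integral_of_le_on_box hint
    (indicator_nonneg fun p _ => hconv0 p)
    (ε := 1 / (2000 * N)) (a := N + 4 - 1 / 20) (k := 1 / 10) (l := N / 10) (m := D / 2)
    (by positivity) (by norm_num) (by positivity) ?_)
  · apply le_of_eq
    field_simp
    norm_num
  intro ξ hξ
  refine ⟨√3 * ξ * (ξ - 8), fun μ hμ => ⟨disp ξ μ + D / 2, fun τ hτ => ?_⟩⟩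
  obtain ⟨m, rfl⟩ : ∃ m, μ = √3 * ξ * (ξ - 8) + m := ⟨μ - √3 * ξ * (ξ - 8), by ring⟩
  obtain ⟨a, rfl⟩ : ∃ a, ξ = N + 4 + a := ⟨ξ - (N + 4), by ring⟩
  have hm : m ∈ Icc 0 (N / 10) := ⟨by linarith [hμ.1], by linarith [hμ.2]⟩
  have ha : a ∈ Icc (-(1 / 20) : ℝ) (1 / 20) := ⟨by linarith [hξ.1], by linarith [hξ.2]⟩
  have hτl := hτ.1
  have hτr := hτ.2
  have hmem : (N + 4 + a, √3 * (N + 4 + a) * (N + 4 + a - 8) + m, τ) ∈ A := by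
    refine ⟨⟨by linarith [ha.1], by linarith [ha.2]⟩, ?_, ?_⟩
    · have hexp : √3 * (N + 4 + a) * (N + 4 + a - 8) + m =
          √3 * N ^ 2 + √3 * (2 * a * N + a ^ 2 - 16) + m := by ring
      have h3 : √3 ≤ 2 := Real.sqrt_le_iff.2 (by norm_num)
      have haN : |2 * a * N + a ^ 2 - 16| ≤ N := by
        rw [abs_le]
        constructor <;> nlinarith [ha.1, ha.2]
      have hb : |√3 * (2 * a * N + a ^ 2 - 16)| ≤ 2 * N := by
        rw [abs_mul, abs_of_nonneg (Real.sqrt_nonneg 3)]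
        exact mul_le_mul h3 haN (abs_nonneg _) (by norm_num)
      have hb' := abs_le.1 hb
      simp only [hexp]
      constructor <;> linarith [hm.1, hm.2, hb'.1, hb'.2]
    · simp only
      rw [abs_of_nonneg (by linarith)]
      constructor <;> linarith
  rw [indicator_of_mem hmem]
  exact conv3_lower_bound hψ hrange hsupp hone hN ⟨by linarith [ha.1], by linarith [ha.2]⟩ hm
    ⟨by linarith, by linarith⟩
end
end

section
/- There exists a universal constant C > 0 such that for all integers k ≥ 100 and all integers j with 0 ≤ j ≤ k, ∫_ℝ sup_{ξ ∈ ℝ\{0}, τ ∈ ℝ} | ∫_ℝ e^{i y μ} · χ_{[k−1,k+1]}(ξ) · χ_{[2k−110,2k+110]}(μ) · μ₀((τ − ω(ξ,μ))/2^j) dμ | dy ≤ C. -/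
open MeasureTheory Real Set

noncomputable section

/-- `χ_m(ξ) = μ₀(ξ/2^m) − μ₀(ξ/2^{m−1})`. -/
def chi (μ₀ : ℝ → ℝ) (m : ℤ) (ξ : ℝ) : ℝ := μ₀ (ξ / 2 ^ m) - μ₀ (ξ / 2 ^ (m - 1))

/-- `χ_{[k₁,k₂]} = Σ_{m=k₁}^{k₂} χ_m`. -/
def chiI (μ₀ : ℝ → ℝ) (k₁ k₂ : ℤ) (ξ : ℝ) : ℝ := ∑ m ∈ Finset.Icc k₁ k₂, chi μ₀ m ξ

/-- Integration by parts against the oscillating exponential. -/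
lemma integral_exp_mul_deriv {g g' : ℝ → ℝ} (hg : ∀ x, HasDerivAt g (g' x) x)
    (hg' : Continuous g') (hs : HasCompactSupport g) (y : ℝ) :
    Complex.I * y * ∫ μ : ℝ, Complex.exp (Complex.I * ((y * μ : ℝ) : ℂ)) * (g μ : ℂ) =
      -∫ μ : ℝ, Complex.exp (Complex.I * ((y * μ : ℝ) : ℂ)) * (g' μ : ℂ) := by
  have hgc : Continuous g := continuous_iff_continuousAt.2 fun x => (hg x).continuousAt
  have hs' : HasCompactSupport g' := by
    rw [show g' = deriv g from funext fun x => (hg x).deriv.symm]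
    exact hs.deriv
  have hgC : HasCompactSupport fun x => (g x : ℂ) := hs.comp_left Complex.ofReal_zero
  have hgC' : HasCompactSupport fun x => (g' x : ℂ) := hs'.comp_left Complex.ofReal_zero
  have hv : ∀ x : ℝ, HasDerivAt (fun μ : ℝ => Complex.exp (Complex.I * ((y * μ : ℝ) : ℂ)))
      (Complex.exp (Complex.I * ((y * x : ℝ) : ℂ)) * (Complex.I * y)) x := by
    intro x
    have h := (((hasDerivAt_id x).const_mul y).ofReal_comp.const_mul Complex.I).cexp
    simpa using h
  have key := integral_mul_deriv_eq_deriv_mul_of_integrable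
    (u := fun x => (g x : ℂ)) (u' := fun x => (g' x : ℂ))
    (v := fun μ : ℝ => Complex.exp (Complex.I * ((y * μ : ℝ) : ℂ)))
    (v' := fun x => Complex.exp (Complex.I * ((y * x : ℝ) : ℂ)) * (Complex.I * y))
    (fun x _ => (hg x).ofReal_comp) (fun x _ => hv x)
    (Continuous.integrable_of_hasCompactSupport (by fun_prop) hgC.mul_right)
    (Continuous.integrable_of_hasCompactSupport (by fun_prop) hgC'.mul_right)
    (Continuous.integrable_of_hasCompactSupport (by fun_prop) hgC.mul_right)
  rw [← integral_const_mul]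
  calc _ = ∫ x, (g x : ℂ) * (Complex.exp (Complex.I * ((y * x : ℝ) : ℂ)) * (Complex.I * y)) := by
        congr 1; ext x; ring
    _ = _ := by
        rw [key]; congr 2; ext x; ring

lemma norm_integral_exp_mul_le {g : ℝ → ℝ} {S : Set ℝ} {A V : ℝ} (hV : volume S ≤ ENNReal.ofReal V)
    (hV0 : 0 ≤ V) (hsupp : ∀ x ∉ S, g x = 0) (hA0 : 0 ≤ A) (hA : ∀ x ∈ S, |g x| ≤ A) (y : ℝ) :
    ‖∫ μ : ℝ, Complex.exp (Complex.I * ((y * μ : ℝ) : ℂ)) * (g μ : ℂ)‖ ≤ A * V := by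
  rw [← setIntegral_eq_integral_of_forall_compl_eq_zero (s := S)
    (fun x hx => by simp [hsupp x hx])]
  refine (norm_setIntegral_le_of_norm_le_const (C := A) (hV.trans_lt ENNReal.ofReal_lt_top)
    fun x hx => ?_).trans ?_
  · rw [norm_mul, mul_comm Complex.I, Complex.norm_exp_ofReal_mul_I, one_mul, Complex.norm_real]
    exact hA x hx
  · gcongr
    exact ENNReal.toReal_le_of_le_ofReal hV0 hV

/-- A function supported in a set of measure at most `V`, with second derivative of size `A₂`,
has Fourier transform of size `V * min A₀ (A₂ / y ^ 2)`. -/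
lemma one_add_sq_mul_norm_integral_exp_mul_le {g g₁ g₂ : ℝ → ℝ} (hg : ∀ x, HasDerivAt g (g₁ x) x)
    (hg₁ : ∀ x, HasDerivAt g₁ (g₂ x) x) (hg₂ : Continuous g₂) {S : Set ℝ} (hS : IsCompact S)
    {A₀ A₂ V r : ℝ} (hV : volume S ≤ ENNReal.ofReal V) (hV0 : 0 ≤ V)
    (hsupp : ∀ x ∉ S, g x = 0) (hA₀ : 0 ≤ A₀) (hA₂ : 0 ≤ A₂) (hgA : ∀ x ∈ S, |g x| ≤ A₀)
    (hgA₂ : ∀ x ∈ S, |g₂ x| ≤ A₂) (y : ℝ) :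
    (1 + (y * r) ^ 2) * ‖∫ μ : ℝ, Complex.exp (Complex.I * ((y * μ : ℝ) : ℂ)) * (g μ : ℂ)‖ ≤
      (A₀ + A₂ * r ^ 2) * V := by
  have hc : HasCompactSupport g := HasCompactSupport.intro hS hsupp
  have ht : tsupport g ⊆ S :=
    closure_minimal (fun x hx => by_contra fun h => hx (hsupp x h)) hS.isClosed
  have e₁ : g₁ = deriv g := funext fun x => (hg x).deriv.symm
  have e₂ : g₂ = deriv g₁ := funext fun x => (hg₁ x).deriv.symm
  have ht₁ : tsupport g₁ ⊆ S := by
    rw [e₁]; exact (closure_minimal support_deriv_subset (isClosed_tsupport g)).trans ht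
  have hsupp₂ : ∀ x ∉ S, g₂ x = 0 := fun x hx => by
    by_contra h
    exact hx (ht₁ (support_deriv_subset (by rwa [← e₂])))
  have hc₁ : HasCompactSupport g₁ := by rw [e₁]; exact hc.deriv
  have hg₁c : Continuous g₁ := continuous_iff_continuousAt.2 fun x => (hg₁ x).continuousAt
  have b₀ := norm_integral_exp_mul_le hV hV0 hsupp hA₀ hgA y
  have b₂ := norm_integral_exp_mul_le hV hV0 hsupp₂ hA₂ hgA₂ y
  have i₁ := integral_exp_mul_deriv hg hg₁c hc y
  have i₂ := integral_exp_mul_deriv hg₁ hg₂ hc₁ y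
  set I₀ := ∫ μ : ℝ, Complex.exp (Complex.I * ((y * μ : ℝ) : ℂ)) * (g μ : ℂ)
  set I₁ := ∫ μ : ℝ, Complex.exp (Complex.I * ((y * μ : ℝ) : ℂ)) * (g₁ μ : ℂ)
  set I₂ := ∫ μ : ℝ, Complex.exp (Complex.I * ((y * μ : ℝ) : ℂ)) * (g₂ μ : ℂ)
  have e : y ^ 2 * ‖I₀‖ = ‖I₂‖ := by
    have h₁ : |y| * ‖I₀‖ = ‖I₁‖ := by simpa using congrArg norm i₁
    have h₂ : |y| * ‖I₁‖ = ‖I₂‖ := by simpa using congrArg norm i₂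
    rw [← h₂, ← h₁, ← sq_abs]; ring
  calc _ = ‖I₀‖ + r ^ 2 * (y ^ 2 * ‖I₀‖) := by ring
    _ ≤ A₀ * V + r ^ 2 * (A₂ * V) := by rw [e]; gcongr
    _ = _ := by ring

/-- A level band of `μ ↦ μ ^ 2 / ξ` away from the origin has small measure. -/
lemma volume_band_le {b w ξ t : ℝ} (hb : 0 < b) (hw : 0 ≤ w) (hξ : ξ ≠ 0) :
    volume {μ : ℝ | b ≤ |μ| ∧ |t - μ ^ 2 / ξ| ≤ w} ≤ ENNReal.ofReal (2 * (w * |ξ| / b)) := by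
  have key : ∀ x z : ℝ, b ≤ x → b ≤ z → |t - x ^ 2 / ξ| ≤ w → |t - z ^ 2 / ξ| ≤ w →
      |x - z| ≤ w * |ξ| / b := by
    intro x z hx hz h₁ h₂
    have h : |(x - z) * (x + z)| ≤ 2 * w * |ξ| := by
      have : (x - z) * (x + z) = ((t - z ^ 2 / ξ) - (t - x ^ 2 / ξ)) * ξ := by field_simp; ring
      rw [this, abs_mul]
      gcongr
      exact (abs_sub _ _).trans (by linarith)
    rw [abs_mul, abs_of_pos (by linarith : 0 < x + z)] at h
    rw [le_div_iff₀ hb]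
    nlinarith [abs_nonneg (x - z)]
  have hd : ∀ s : Set ℝ, (∀ x ∈ s, ∀ z ∈ s, |x - z| ≤ w * |ξ| / b) →
      volume s ≤ ENNReal.ofReal (w * |ξ| / b) := fun s hs =>
    (Real.volume_le_diam s).trans <| Metric.ediam_le fun x hx z hz => by
      rw [edist_dist, Real.dist_eq]; exact ENNReal.ofReal_le_ofReal (hs x hx z hz)
  have hsub : {μ : ℝ | b ≤ |μ| ∧ |t - μ ^ 2 / ξ| ≤ w} ⊆
      {μ : ℝ | b ≤ μ ∧ |t - μ ^ 2 / ξ| ≤ w} ∪ {μ : ℝ | b ≤ -μ ∧ |t - μ ^ 2 / ξ| ≤ w} := by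
    rintro μ ⟨h, h'⟩
    exact (le_abs.1 h).imp (⟨·, h'⟩) (⟨·, h'⟩)
  refine (measure_mono hsub).trans ((measure_union_le _ _).trans ?_)
  rw [two_mul, ENNReal.ofReal_add (by positivity) (by positivity)]
  refine add_le_add (hd _ fun x hx z hz => key x z hx.1 hz.1 hx.2 hz.2) (hd _ fun x hx z hz => ?_)
  have := key (-x) (-z) hx.1 hz.1 (by simpa using hx.2) (by simpa using hz.2)
  rwa [← abs_neg, show -(x - z) = -x - -z by ring]

/-- The kernel bound at a fixed frequency `ξ` of size `B`, modulation `D`, with `μ` of size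
between `β * B ^ 2` and `α * B ^ 2`. -/
lemma one_add_sq_mul_norm_kernel_le {f f₁ f₂ : ℝ → ℝ} {M α β : ℝ}
    (hf : ∀ x, HasDerivAt f (f₁ x) x) (hf₁ : ∀ x, HasDerivAt f₁ (f₂ x) x) (hf₂ : Continuous f₂)
    (hrange : ∀ s, f s ∈ Icc (0 : ℝ) 1) (hsupp : Function.support f ⊆ Icc (-8/5 : ℝ) (8/5))
    (hone : ∀ s ∈ Icc (-5/4 : ℝ) (5/4 : ℝ), f s = 1)
    (hM₁ : ∀ s, |f₁ s| ≤ M) (hM₂ : ∀ s, |f₂ s| ≤ M) (hβ : 0 < β) (hβα : β ≤ α)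
    {B D ξ : ℝ} (hD : 1 ≤ D) (hDB : D ≤ B) (hξ : B ≤ 4 * |ξ|) (hξ' : |ξ| ≤ 4 * B)
    (hαB : 1 ≤ α * B ^ 2) (hβB : 1 ≤ β * B ^ 2) {c : ℝ} (hc : |c| ≤ 1) (τ y : ℝ) :
    (1 + (y * (D / B)) ^ 2) * ‖∫ μ : ℝ, Complex.exp (Complex.I * ((y * μ : ℝ) : ℂ)) *
      ((c * (f (μ / (α * B ^ 2)) - f (μ / (β * B ^ 2))) * f ((τ - disp ξ μ) / D) : ℝ) : ℂ)‖ ≤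
      (1 + (10 * M + 64 * α * M ^ 2 + 256 * α ^ 2 * M)) * (12 / β) * (D / B) := by
  have hα : 0 < α := hβ.trans_le hβα
  have hM : 0 ≤ M := (abs_nonneg _).trans (hM₁ 0)
  have hB0 : 0 < B := by linarith
  have hD0 : 0 < D := by linarith
  have hξa : 0 < |ξ| := by linarith
  have hξ0 : ξ ≠ 0 := abs_pos.1 hξa
  set P := α * B ^ 2 with hP
  set Q := β * B ^ 2 with hQ
  have hP0 : 0 < P := by linarith
  have hQ0 : 0 < Q := by linarith
  have hQP : Q ≤ P := by rw [hP, hQ]; gcongr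
  set p : ℝ → ℝ := fun μ => (τ - disp ξ μ) / D with hp
  set p₁ : ℝ → ℝ := fun μ => -(2 * μ / ξ) / D with hp₁
  set p₂ : ℝ := -(2 / ξ) / D with hp₂
  have dp : ∀ x, HasDerivAt p (p₁ x) x := by
    intro x
    have h := (((((hasDerivAt_id x).pow 2).div_const ξ).const_add (ξ ^ 3)).const_sub τ).div_const D
    simpa [hp, hp₁, disp] using h
  have dp₁ : ∀ x, HasDerivAt p₁ p₂ x := by
    intro x
    have h := ((((hasDerivAt_id x).const_mul 2).div_const ξ).neg).div_const D
    simpa [hp₁, hp₂] using h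
  set a : ℝ → ℝ := fun μ => f (μ / P) - f (μ / Q) with ha
  set a₁ : ℝ → ℝ := fun μ => f₁ (μ / P) * (1 / P) - f₁ (μ / Q) * (1 / Q) with ha₁
  set a₂ : ℝ → ℝ := fun μ => f₂ (μ / P) * (1 / P) * (1 / P) - f₂ (μ / Q) * (1 / Q) * (1 / Q) with ha₂
  have dscale : ∀ (h h' : ℝ → ℝ) (R : ℝ), (∀ x, HasDerivAt h (h' x) x) →
      ∀ x, HasDerivAt (fun μ => h (μ / R)) (h' (x / R) * (1 / R)) x := fun h h' R hh x =>
    (hh (x / R)).comp x ((hasDerivAt_id x).div_const R)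
  have da : ∀ x, HasDerivAt a (a₁ x) x := fun x => (dscale _ _ P hf x).sub (dscale _ _ Q hf x)
  have da₁ : ∀ x, HasDerivAt a₁ (a₂ x) x := fun x =>
    ((dscale _ _ P hf₁ x).mul_const _).sub ((dscale _ _ Q hf₁ x).mul_const _)
  have db : ∀ x, HasDerivAt (fun μ => f (p μ)) (f₁ (p x) * p₁ x) x := fun x =>
    (hf (p x)).comp x (dp x)
  have db₁ : ∀ x, HasDerivAt (fun μ => f₁ (p μ) * p₁ μ)
      (f₂ (p x) * p₁ x * p₁ x + f₁ (p x) * p₂) x := fun x =>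
    ((hf₁ (p x)).comp x (dp x)).mul (dp₁ x)
  have cf : Continuous f := continuous_iff_continuousAt.2 fun x => (hf x).continuousAt
  have cf₁ : Continuous f₁ := continuous_iff_continuousAt.2 fun x => (hf₁ x).continuousAt
  have cp : Continuous p := continuous_iff_continuousAt.2 fun x => (dp x).continuousAt
  have cp₁ : Continuous p₁ := continuous_iff_continuousAt.2 fun x => (dp₁ x).continuousAt
  have hzero : ∀ s, 8 / 5 < |s| → f s = 0 := fun s hs => by
    by_contra h
    have := hsupp h
    exact absurd (abs_le.2 ⟨by linarith [this.1], this.2⟩ : |s| ≤ 8 / 5) (not_le.2 hs)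
  set S : Set ℝ := {μ : ℝ | |μ| ≤ 8 / 5 * P} ∩
    {μ : ℝ | 5 / 4 * Q ≤ |μ| ∧ |(τ - ξ ^ 3) - μ ^ 2 / ξ| ≤ 8 / 5 * D} with hS
  have hSc : IsCompact S := by
    refine IsCompact.inter_right ?_ ?_
    · convert isCompact_Icc (a := -(8 / 5 * P)) (b := 8 / 5 * P) using 1
      ext x; simp [abs_le]
    · exact (isClosed_le continuous_const continuous_abs).inter
        (isClosed_le (f := fun μ : ℝ => |(τ - ξ ^ 3) - μ ^ 2 / ξ|) (by fun_prop) continuous_const)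
  have hV : volume S ≤ ENNReal.ofReal (12 / β * (D / B)) := by
    refine (measure_mono inter_subset_right).trans ((volume_band_le (by positivity)
      (by positivity) hξ0).trans (ENNReal.ofReal_le_ofReal ?_))
    calc 2 * (8 / 5 * D * |ξ| / (5 / 4 * Q)) ≤ 2 * (8 / 5 * D * (4 * B) / (5 / 4 * Q)) := by gcongr
      _ = (256 / 25) / β * (D / B) := by rw [hQ]; field_simp; norm_num
      _ ≤ _ := by gcongr; norm_num
  have hSz : ∀ x ∉ S, c * a x * f (p x) = 0 := by
    intro x hx
    by_cases h₁ : |x| ≤ 8 / 5 * P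
    · by_cases h₂ : 5 / 4 * Q ≤ |x|
      · have h₃ : 8 / 5 * D < |(τ - ξ ^ 3) - x ^ 2 / ξ| := by
          by_contra h
          exact hx ⟨h₁, h₂, not_lt.1 h⟩
        rw [hzero (p x), mul_zero]
        simp only [hp, disp]
        rwa [abs_div, abs_of_pos hD0, lt_div_iff₀ hD0, ← sub_sub]
      · have one : ∀ R, Q ≤ R → f (x / R) = 1 := fun R hR => by
          have hR0 : 0 < R := hQ0.trans_le hR
          have : |x / R| ≤ 5 / 4 := by
            rw [abs_div, abs_of_pos hR0, div_le_iff₀ hR0]; linarith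
          exact hone _ ⟨by linarith [(abs_le.1 this).1], (abs_le.1 this).2⟩
        simp [ha, one P hQP, one Q le_rfl]
    · have zero : ∀ R, 0 < R → R ≤ P → f (x / R) = 0 := fun R hR0 hR => by
        refine hzero _ ?_
        rw [abs_div, abs_of_pos hR0, lt_div_iff₀ hR0]; linarith
      simp [ha, zero P hP0 le_rfl, zero Q hQ0 hQP]
  have hp₁S : ∀ x ∈ S, |p₁ x| ≤ 16 * α * (B / D) := by
    intro x hx
    have hx : |x| ≤ 8 / 5 * P := hx.1
    rw [hp₁, abs_div, abs_neg, abs_div, abs_mul, abs_two, abs_of_pos hD0]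
    calc 2 * |x| / |ξ| / D ≤ 2 * (8 / 5 * P) / (B / 4) / D := by gcongr; linarith
      _ = 64 / 5 * α * (B / D) := by rw [hP]; field_simp; norm_num
      _ ≤ _ := by gcongr; norm_num
  have hp₂' : |p₂| ≤ 8 := by
    rw [hp₂, abs_div, abs_neg, abs_div, abs_two, abs_of_pos hD0, div_div, div_le_iff₀ (by positivity)]
    nlinarith
  have hL : 1 ≤ B / D := (one_le_div hD0).2 hDB
  have hfa : ∀ s, |f s| ≤ 1 := fun s => abs_le.2 ⟨by linarith [(hrange s).1], (hrange s).2⟩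
  have haA : ∀ x, |a x| ≤ 1 := fun _ =>
    abs_sub_le_of_nonneg_of_le (hrange _).1 (hrange _).2 (hrange _).1 (hrange _).2
  have hiP : |1 / P| ≤ 1 := by
    rw [abs_of_pos (by positivity)]; exact (div_le_one hP0).2 hαB
  have hiQ : |1 / Q| ≤ 1 := by
    rw [abs_of_pos (by positivity)]; exact (div_le_one hQ0).2 hβB
  have haA₁ : ∀ x, |a₁ x| ≤ 2 * M := fun x => by
    have h₁ : |f₁ (x / P) * (1 / P)| ≤ M * 1 := by
      rw [abs_mul]; gcongr; exact hM₁ _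
    have h₂ : |f₁ (x / Q) * (1 / Q)| ≤ M * 1 := by
      rw [abs_mul]; gcongr; exact hM₁ _
    exact (abs_sub _ _).trans (by linarith)
  have haA₂ : ∀ x, |a₂ x| ≤ 2 * M := fun x => by
    have h₁ : |f₂ (x / P) * (1 / P) * (1 / P)| ≤ M * 1 * 1 := by
      rw [abs_mul, abs_mul]; gcongr; exact hM₂ _
    have h₂ : |f₂ (x / Q) * (1 / Q) * (1 / Q)| ≤ M * 1 * 1 := by
      rw [abs_mul, abs_mul]; gcongr; exact hM₂ _
    exact (abs_sub _ _).trans (by linarith)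
  have main := one_add_sq_mul_norm_integral_exp_mul_le
    (g := fun μ => c * a μ * f (p μ))
    (g₁ := fun μ => c * a₁ μ * f (p μ) + c * a μ * (f₁ (p μ) * p₁ μ))
    (g₂ := fun μ => (c * a₂ μ * f (p μ) + c * a₁ μ * (f₁ (p μ) * p₁ μ)) +
      (c * a₁ μ * (f₁ (p μ) * p₁ μ) + c * a μ * (f₂ (p μ) * p₁ μ * p₁ μ + f₁ (p μ) * p₂)))
    (A₀ := 1) (A₂ := (10 * M + 64 * α * M ^ 2 + 256 * α ^ 2 * M) * (B / D) ^ 2) (r := D / B)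
    (fun x => ((da x).const_mul c).mul (db x))
    (fun x => (((da₁ x).const_mul c).mul (db x)).add (((da x).const_mul c).mul (db₁ x)))
    (by fun_prop) hSc hV (by positivity) hSz zero_le_one (by positivity)
    (fun x _ => by
      rw [abs_mul, abs_mul]
      exact mul_le_one₀ (mul_le_one₀ hc (abs_nonneg _) (haA x)) (abs_nonneg _) (hfa _))
    (fun x hx => by
      have hf₁p : |f₁ (p x) * p₁ x| ≤ M * (16 * α * (B / D)) := by
        rw [abs_mul]; exact mul_le_mul (hM₁ _) (hp₁S x hx) (abs_nonneg _) hM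
      have hb₂ : |f₂ (p x) * p₁ x * p₁ x + f₁ (p x) * p₂| ≤
          M * (16 * α * (B / D)) * (16 * α * (B / D)) + M * 8 := by
        refine (abs_add_le _ _).trans (add_le_add ?_ ?_)
        · rw [abs_mul, abs_mul]
          have := hp₁S x hx
          gcongr
          exact hM₂ _
        · rw [abs_mul]
          gcongr
          exact hM₁ _
      have t₁ : |c * a₂ x * f (p x)| ≤ 1 * (2 * M) * 1 := by
        rw [abs_mul, abs_mul]; gcongr; exacts [haA₂ x, hfa _]
      have t₂ : |c * a₁ x * (f₁ (p x) * p₁ x)| ≤ 1 * (2 * M) * (M * (16 * α * (B / D))) := by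
        rw [abs_mul (c * a₁ x), abs_mul c]; gcongr; exact haA₁ x
      have t₃ : |c * a x * (f₂ (p x) * p₁ x * p₁ x + f₁ (p x) * p₂)| ≤
          1 * 1 * (M * (16 * α * (B / D)) * (16 * α * (B / D)) + M * 8) := by
        rw [abs_mul (c * a x), abs_mul c]; gcongr; exact haA x
      refine (abs_add_le _ _).trans ((add_le_add (abs_add_le _ _) (abs_add_le _ _)).trans ?_)
      refine (add_le_add (add_le_add t₁ t₂) (add_le_add t₂ t₃)).trans ?_
      set L := B / D
      have hL₂ : L ≤ L ^ 2 := by nlinarith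
      have hL₁ : 1 ≤ L ^ 2 := hL.trans hL₂
      calc _ = 10 * M * 1 + 64 * α * M ^ 2 * L + 256 * α ^ 2 * M * L ^ 2 := by ring
        _ ≤ 10 * M * L ^ 2 + 64 * α * M ^ 2 * L ^ 2 + 256 * α ^ 2 * M * L ^ 2 := by gcongr
        _ = _ := by ring) y
  refine main.trans (le_of_eq ?_)
  field_simp

lemma chiI_eq (f : ℝ → ℝ) {k₁ k₂ : ℤ} (h : k₁ ≤ k₂) (x : ℝ) :
    chiI f k₁ k₂ x = f (x / 2 ^ k₂) - f (x / 2 ^ (k₁ - 1)) := by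
  induction k₂, h using Int.leInduction with
  | base => simp [chiI, chi]
  | succ n hn ih =>
    have hu : Finset.Icc k₁ (n + 1) = insert (n + 1) (Finset.Icc k₁ n) := by
      ext m; simp only [Finset.mem_Icc, Finset.mem_insert]; omega
    rw [chiI, hu, Finset.sum_insert (by simp), ← chiI, ih, chi, add_sub_cancel_right]
    ring

theorem kernel_L1_bound (μ₀ : ℝ → ℝ)
    (hsmooth : ContDiff ℝ (⊤ : ℕ∞) μ₀) (hrange : ∀ s, μ₀ s ∈ Icc (0:ℝ) 1)
    (hsupp : Function.support μ₀ ⊆ Icc (-8/5 : ℝ) (8/5))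
    (hone : ∀ s ∈ Icc (-5/4 : ℝ) (5/4 : ℝ), μ₀ s = 1)
    (heven : ∀ s, μ₀ (-s) = μ₀ s) :
    ∃ C : ℝ, 0 < C ∧ ∀ k j : ℤ, 100 ≤ k → 0 ≤ j → j ≤ k →
      ∫ y : ℝ,
        ⨆ (ξ : ℝ) (_ : ξ ≠ 0) (τ : ℝ),
          ‖∫ μ : ℝ, Complex.exp (Complex.I * ((y * μ : ℝ) : ℂ)) *
            ((chiI μ₀ (k - 1) (k + 1) ξ * chiI μ₀ (2*k - 110) (2*k + 110) μ *
                μ₀ ((τ - disp ξ μ) / 2 ^ j) : ℝ) : ℂ)‖ ≤ C := by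
  have hd : Differentiable ℝ μ₀ := hsmooth.differentiable (by simp)
  have hsmooth₁ : ContDiff ℝ (⊤ : ℕ∞) (deriv μ₀) := (contDiff_infty_iff_deriv.1 hsmooth).2
  have hd₁ : Differentiable ℝ (deriv μ₀) := hsmooth₁.differentiable (by simp)
  have hc₂ : Continuous (deriv (deriv μ₀)) := hsmooth₁.continuous_deriv (by simp)
  have hcs : HasCompactSupport μ₀ := HasCompactSupport.intro isCompact_Icc
    fun x hx => by_contra fun h => hx (hsupp h)
  obtain ⟨M₁, hM₁⟩ := hd₁.continuous.bounded_above_of_compact_support hcs.deriv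
  obtain ⟨M₂, hM₂⟩ := hc₂.bounded_above_of_compact_support hcs.deriv.deriv
  have hM0 : 0 ≤ max M₁ M₂ := (norm_nonneg _).trans ((hM₁ 0).trans (le_max_left _ _))
  set M := max M₁ M₂
  set α : ℝ := 2 ^ 110 with hα
  set β : ℝ := (2 ^ 111)⁻¹ with hβ
  set K : ℝ := (1 + (10 * M + 64 * α * M ^ 2 + 256 * α ^ 2 * M)) * (12 / β)
  have hK : 0 < K := by positivity
  refine ⟨K * π, by positivity, fun k j hk hj hjk => ?_⟩
  have hB : (2 : ℝ) ^ (100 : ℤ) ≤ 2 ^ k := zpow_le_zpow_right₀ one_le_two hk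
  have hD : (1 : ℝ) ≤ 2 ^ j := one_le_zpow₀ one_le_two hj
  have hDB : (2 : ℝ) ^ j ≤ 2 ^ k := zpow_le_zpow_right₀ one_le_two hjk
  have hkP : (2 : ℝ) ^ (2 * k + 110) = α * (2 ^ k) ^ 2 := by
    rw [hα, zpow_add₀ two_ne_zero, two_mul, zpow_add₀ two_ne_zero]; norm_cast; ring
  have hkQ : (2 : ℝ) ^ (2 * k - 110 - 1) = β * (2 ^ k) ^ 2 := by
    rw [hβ, sub_sub, zpow_sub₀ two_ne_zero, two_mul, zpow_add₀ two_ne_zero]; norm_cast; ring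
  have hkξ : (2 : ℝ) ^ (k + 1) = 2 * 2 ^ k := by
    rw [zpow_add₀ two_ne_zero]; ring
  have hkξ' : (2 : ℝ) ^ (k - 1 - 1) = 2 ^ k / 4 := by
    rw [sub_sub, zpow_sub₀ two_ne_zero]; norm_num
  rw [show (2 : ℝ) ^ (100 : ℤ) = 2 ^ 100 by norm_cast] at hB
  set B : ℝ := 2 ^ k
  set D : ℝ := 2 ^ j
  have hB0 : 0 < B := by positivity
  have hD0 : 0 < D := by positivity
  have hr : 0 < D / B := by positivity
  have hβB : 1 ≤ β * B ^ 2 := by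
    calc (1 : ℝ) ≤ β * (2 ^ 100) ^ 2 := by rw [hβ]; norm_num
      _ ≤ _ := by gcongr
  have hβα : β ≤ α := by rw [hα, hβ]; norm_num
  have hpt : ∀ y ξ τ : ℝ, ‖∫ μ : ℝ, Complex.exp (Complex.I * ((y * μ : ℝ) : ℂ)) *
      ((chiI μ₀ (k - 1) (k + 1) ξ * chiI μ₀ (2*k - 110) (2*k + 110) μ *
        μ₀ ((τ - disp ξ μ) / D) : ℝ) : ℂ)‖ ≤ K * (D / B) * (1 + (y * (D / B)) ^ 2)⁻¹ := by
    intro y ξ τ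
    by_cases hc : chiI μ₀ (k - 1) (k + 1) ξ = 0
    · simp only [hc, zero_mul, Complex.ofReal_zero, mul_zero, integral_zero, norm_zero]
      positivity
    have hχξ := chiI_eq μ₀ (by omega : k - 1 ≤ k + 1) ξ
    simp only [chiI_eq μ₀ (by omega : 2 * k - 110 ≤ 2 * k + 110), hkP, hkQ]
    rw [← div_eq_mul_inv, le_div_iff₀ (by positivity), mul_comm]
    rw [hkξ, hkξ'] at hχξ
    have hξ : B ≤ 4 * |ξ| := by
      by_contra! h
      have one : ∀ R, B / 4 ≤ R → μ₀ (ξ / R) = 1 := fun R hR => by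
        have hR0 : 0 < R := by linarith
        have : |ξ / R| ≤ 5 / 4 := by
          rw [abs_div, abs_of_pos hR0, div_le_iff₀ hR0]; linarith
        exact hone _ ⟨by linarith [(abs_le.1 this).1], (abs_le.1 this).2⟩
      exact hc (by rw [hχξ, one _ (by linarith), one _ le_rfl, sub_self])
    have hξ' : |ξ| ≤ 4 * B := by
      by_contra! h
      have zero : ∀ R, 0 < R → R ≤ 2 * B → μ₀ (ξ / R) = 0 := fun R hR0 hR => by
        have : 8 / 5 < |ξ / R| := by
          rw [abs_div, abs_of_pos hR0, lt_div_iff₀ hR0]; linarith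
        by_contra h
        have h := hsupp h
        exact absurd (abs_le.2 ⟨by linarith [h.1], h.2⟩ : |ξ / R| ≤ 8 / 5) (not_le.2 this)
      exact hc (by rw [hχξ, zero _ (by positivity) le_rfl, zero _ (by positivity) (by linarith),
        sub_self])
    have hc1 : |chiI μ₀ (k - 1) (k + 1) ξ| ≤ 1 := by
      rw [hχξ]
      exact abs_sub_le_of_nonneg_of_le (hrange _).1 (hrange _).2 (hrange _).1 (hrange _).2
    exact one_add_sq_mul_norm_kernel_le (fun x => (hd x).hasDerivAt) (fun x => (hd₁ x).hasDerivAt)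
      hc₂ hrange hsupp hone (fun s => (hM₁ s).trans (le_max_left _ _))
      (fun s => (hM₂ s).trans (le_max_right _ _)) (by positivity) hβα hD hDB hξ hξ'
      (hβB.trans (by gcongr)) hβB hc1 τ y
  have hint : Integrable fun y : ℝ => K * (D / B) * (1 + (y * (D / B)) ^ 2)⁻¹ :=
    (integrable_inv_one_add_sq.comp_mul_right' hr.ne').const_mul _
  have hval : ∫ y : ℝ, K * (D / B) * (1 + (y * (D / B)) ^ 2)⁻¹ = K * π := by
    rw [integral_const_mul,
      Measure.integral_comp_mul_right (fun x : ℝ => (1 + x ^ 2)⁻¹) (D / B),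
      integral_univ_inv_one_add_sq, abs_of_pos (by positivity), smul_eq_mul]
    field_simp
  rw [← hval]
  refine integral_mono_of_nonneg (ae_of_all _ fun y => ?_) hint (ae_of_all _ fun y => ?_)
  · exact Real.iSup_nonneg fun ξ => Real.iSup_nonneg fun _ => Real.iSup_nonneg fun τ =>
      norm_nonneg _
  · have h0 : 0 ≤ K * (D / B) * (1 + (y * (D / B)) ^ 2)⁻¹ := by positivity
    exact Real.iSup_le (fun ξ => Real.iSup_le (fun _ => Real.iSup_le (fun τ => hpt y ξ τ) h0) h0) h0
end
end

section
/- There exists a universal constant C > 0 such that for all integers k ≤ 0 and l ≥ 0, ∫_ℝ sup_{x ∈ ℝ, |t| ≤ 1} | ∫_{ℝ²} χ_{[k−1,k+1]}(ξ)² · μ₀(μ/2^l)² · e^{i(xξ + yμ + tω(ξ,μ))} dξ dμ | dy ≤ C · 2^{(2l+k)/2}. -/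
open MeasureTheory Real Set

noncomputable section

/-- The oscillatory integral `∫_{-2}^{2} φ(ν) e^{i(aν + bν²)} dν`. -/
def oscIntegral (φ : ℝ → ℝ) (a b : ℝ) : ℂ :=
  ∫ ν in (-2 : ℝ)..2, (φ ν : ℂ) * Complex.exp (Complex.I * ((a * ν + b * ν ^ 2 : ℝ) : ℂ))

lemma hasDerivAt_cexp_quadratic (a b ν : ℝ) :
    HasDerivAt (fun u : ℝ => Complex.exp (Complex.I * ((a * u + b * u ^ 2 : ℝ) : ℂ)))
      (Complex.exp (Complex.I * ((a * ν + b * ν ^ 2 : ℝ) : ℂ)) *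
        (Complex.I * ((a + 2 * b * ν : ℝ) : ℂ))) ν := by
  have h : HasDerivAt (fun u : ℝ => a * u + b * u ^ 2) (a + 2 * b * ν) ν := by
    refine (((hasDerivAt_id' ν).const_mul a).add
      (((hasDerivAt_id' ν).fun_pow 2).const_mul b)).congr_deriv ?_
    simp
    ring
  exact (h.ofReal_comp.const_mul Complex.I).cexp

lemma norm_fresnel_le_of_one_le {T : ℝ} (hT : 1 ≤ T) :
    ‖∫ u in (1 : ℝ)..T, Complex.exp (Complex.I * ((u ^ 2 : ℝ) : ℂ))‖ ≤ 1 := by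
  have hpos : ∀ u ∈ uIcc 1 T, 0 < u := fun u hu => by
    rw [uIcc_of_le hT] at hu; linarith [hu.1]
  have hne : ∀ u ∈ uIcc 1 T, (u : ℂ) ≠ 0 := fun u hu => by
    exact_mod_cast (hpos u hu).ne'
  have hd : ∀ u ∈ uIcc 1 T, HasDerivAt
      (fun u : ℝ => Complex.exp (Complex.I * ((u ^ 2 : ℝ) : ℂ)) / (2 * Complex.I * u))
      (Complex.exp (Complex.I * ((u ^ 2 : ℝ) : ℂ)) -
        Complex.exp (Complex.I * ((u ^ 2 : ℝ) : ℂ)) / (2 * Complex.I * u ^ 2)) u := by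
    intro u hu
    have h1 := hasDerivAt_cexp_quadratic 0 1 u
    have h2 : HasDerivAt (fun u : ℝ => 2 * Complex.I * (u : ℂ)) (2 * Complex.I) u := by
      simpa using (hasDerivAt_id u).ofReal_comp.const_mul (2 * Complex.I)
    have h3 := h1.div h2 (by simp [hne u hu])
    simp only [zero_mul, one_mul, zero_add] at h3
    refine h3.congr_deriv ?_
    have := hne u hu
    have := Complex.I_ne_zero
    push_cast
    field_simp
  have hcE : Continuous fun u : ℝ => Complex.exp (Complex.I * ((u ^ 2 : ℝ) : ℂ)) := by fun_prop
  have hcQ : ContinuousOn (fun u : ℝ =>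
      Complex.exp (Complex.I * ((u ^ 2 : ℝ) : ℂ)) / (2 * Complex.I * u ^ 2)) (uIcc 1 T) := by
    refine hcE.continuousOn.div (by fun_prop) fun u hu => ?_
    simp [hne u hu]
  have hftc := intervalIntegral.integral_eq_sub_of_hasDerivAt hd
    ((hcE.intervalIntegrable _ _).sub hcQ.intervalIntegrable)
  rw [intervalIntegral.integral_sub (hcE.intervalIntegrable _ _) hcQ.intervalIntegrable,
    sub_eq_iff_eq_add] at hftc
  have hinv : ∫ u in (1 : ℝ)..T, (1 / 2) * (u ^ 2)⁻¹ = 1 / 2 - 1 / 2 * T⁻¹ := by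
    rw [intervalIntegral.integral_eq_sub_of_hasDerivAt (f := fun u => -(1 / 2) * u⁻¹)]
    · simp; ring
    · intro u hu
      exact ((hasDerivAt_inv (hpos u hu).ne').const_mul (-(1 / 2))).congr_deriv (by ring)
    · refine ContinuousOn.intervalIntegrable (ContinuousOn.mul (by fun_prop) ?_)
      exact ContinuousOn.inv₀ (by fun_prop) fun u hu => (pow_pos (hpos u hu) 2).ne'
  have hQ : ‖∫ u in (1 : ℝ)..T,
      Complex.exp (Complex.I * ((u ^ 2 : ℝ) : ℂ)) / (2 * Complex.I * u ^ 2)‖ ≤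
      1 / 2 - 1 / 2 * T⁻¹ := by
    rw [← hinv]
    refine intervalIntegral.norm_integral_le_of_norm_le hT ?_ ?_
    · refine Filter.Eventually.of_forall fun u hu => ?_
      rw [norm_div, Complex.norm_exp_I_mul_ofReal]
      simp [mul_comm]
    · refine ContinuousOn.intervalIntegrable (ContinuousOn.mul (by fun_prop) ?_)
      exact ContinuousOn.inv₀ (by fun_prop) fun u hu => (pow_pos (hpos u hu) 2).ne'
  have hbd : ∀ u : ℝ, 0 < u →
      ‖Complex.exp (Complex.I * ((u ^ 2 : ℝ) : ℂ)) / (2 * Complex.I * u)‖ = 1 / 2 * u⁻¹ := by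
    intro u hu
    rw [norm_div, Complex.norm_exp_I_mul_ofReal]
    simp [abs_of_pos hu]
    ring
  rw [hftc]
  refine (norm_add_le _ _).trans ?_
  refine (add_le_add (norm_sub_le _ _) hQ).trans ?_
  rw [hbd T (by linarith), hbd 1 one_pos]
  linarith

lemma norm_fresnel_le (T : ℝ) :
    ‖∫ u in (0 : ℝ)..T, Complex.exp (Complex.I * ((u ^ 2 : ℝ) : ℂ))‖ ≤ 2 := by
  have hcE : Continuous fun u : ℝ => Complex.exp (Complex.I * ((u ^ 2 : ℝ) : ℂ)) := by fun_prop
  have key : ∀ T : ℝ, 0 ≤ T →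
      ‖∫ u in (0 : ℝ)..T, Complex.exp (Complex.I * ((u ^ 2 : ℝ) : ℂ))‖ ≤ 2 := by
    intro T hT
    have triv : ∀ S : ℝ, 0 ≤ S →
        ‖∫ u in (0 : ℝ)..S, Complex.exp (Complex.I * ((u ^ 2 : ℝ) : ℂ))‖ ≤ S := by
      intro S hS
      refine (intervalIntegral.norm_integral_le_of_norm_le_const (C := 1) fun u _ => ?_).trans ?_
      · rw [Complex.norm_exp_I_mul_ofReal]
      · simp [abs_of_nonneg hS]
    rcases le_total T 1 with h | h
    · linarith [triv T hT]
    · rw [← intervalIntegral.integral_add_adjacent_intervals (b := 1)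
        (hcE.intervalIntegrable _ _) (hcE.intervalIntegrable _ _)]
      refine (norm_add_le _ _).trans ?_
      linarith [triv 1 zero_le_one, norm_fresnel_le_of_one_le h]
  rcases le_total 0 T with h | h
  · exact key T h
  · have := intervalIntegral.integral_comp_neg (a := 0) (b := -T)
      (fun u : ℝ => Complex.exp (Complex.I * ((u ^ 2 : ℝ) : ℂ)))
    simp only [neg_sq, neg_neg, neg_zero] at this
    rw [intervalIntegral.integral_symm, ← this, norm_neg]
    exact key (-T) (by linarith)

lemma norm_integral_cexp_quadratic_le (a : ℝ) {b : ℝ} (hb : 0 < b) (α β : ℝ) :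
    ‖∫ u in α..β, Complex.exp (Complex.I * ((a * u + b * u ^ 2 : ℝ) : ℂ))‖ ≤ 4 / √b := by
  have hs : 0 < √b := sqrt_pos.2 hb
  have hcE : Continuous fun u : ℝ => Complex.exp (Complex.I * ((u ^ 2 : ℝ) : ℂ)) := by fun_prop
  have hsq : ∀ u : ℝ, Complex.exp (Complex.I * ((a * u + b * u ^ 2 : ℝ) : ℂ)) =
      Complex.exp (Complex.I * ((-(a ^ 2 / (4 * b)) : ℝ) : ℂ)) *
        Complex.exp (Complex.I * (((√b * u + a / (2 * √b)) ^ 2 : ℝ) : ℂ)) := by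
    intro u
    rw [← Complex.exp_add, ← mul_add, ← Complex.ofReal_add]
    congr 3
    have h2 : √b ^ 2 = b := sq_sqrt hb.le
    rw [add_sq, mul_pow, div_pow, mul_pow, h2]
    field_simp
    ring
  simp_rw [hsq]
  rw [intervalIntegral.integral_const_mul, norm_mul, Complex.norm_exp_I_mul_ofReal, one_mul,
    intervalIntegral.integral_comp_mul_add
      (fun u : ℝ => Complex.exp (Complex.I * ((u ^ 2 : ℝ) : ℂ))) hs.ne',
    ← intervalIntegral.integral_interval_sub_left (a := 0)
      (hcE.intervalIntegrable _ _) (hcE.intervalIntegrable _ _), norm_smul, norm_inv,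
    Real.norm_of_nonneg hs.le, div_eq_inv_mul 4]
  refine mul_le_mul_of_nonneg_left ?_ (inv_nonneg.2 hs.le)
  refine (norm_sub_le _ _).trans ?_
  linarith [norm_fresnel_le (√b * β + a / (2 * √b)), norm_fresnel_le (√b * α + a / (2 * √b))]

lemma norm_oscIntegral_neg (φ : ℝ → ℝ) (a b : ℝ) :
    ‖oscIntegral φ (-a) (-b)‖ = ‖oscIntegral φ a b‖ := by
  rw [← Complex.norm_conj (oscIntegral φ a b), oscIntegral, oscIntegral,
    ← intervalIntegral.intervalIntegral_conj]
  congr 2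
  ext ν
  rw [map_mul, ← Complex.exp_conj, map_mul, Complex.conj_I, Complex.conj_ofReal,
    Complex.conj_ofReal]
  congr 2
  push_cast
  ring

lemma norm_oscIntegral_le {φ : ℝ → ℝ} {B : ℝ}
    (hB : ∀ ν ∈ Icc (-2 : ℝ) 2, |φ ν| ≤ B) (a b : ℝ) : ‖oscIntegral φ a b‖ ≤ 4 * B := by
  refine (intervalIntegral.norm_integral_le_of_norm_le_const (C := B) fun ν hν => ?_).trans ?_
  · rw [uIoc_of_le (by norm_num)] at hν
    rw [norm_mul, Complex.norm_exp_I_mul_ofReal, mul_one, Complex.norm_real]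
    exact hB ν ⟨hν.1.le, hν.2⟩
  · norm_num; linarith

lemma norm_oscIntegral_le_div_sqrt_of_pos {φ φ₁ : ℝ → ℝ} {B : ℝ}
    (hφ : ∀ ν, HasDerivAt φ (φ₁ ν) ν) (hc : Continuous φ₁)
    (hB : ∀ ν ∈ Icc (-2 : ℝ) 2, |φ₁ ν| ≤ B) (h0 : φ (-2) = 0) (h1 : φ 2 = 0)
    (a : ℝ) {b : ℝ} (hb : 0 < b) : ‖oscIntegral φ a b‖ ≤ 16 * B / √b := by
  have hE : Continuous fun u : ℝ => Complex.exp (Complex.I * ((a * u + b * u ^ 2 : ℝ) : ℂ)) := by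
    fun_prop
  have hparts := intervalIntegral.integral_mul_deriv_eq_deriv_mul (a := -2) (b := 2)
    (u := fun ν : ℝ => (φ ν : ℂ)) (u' := fun ν : ℝ => (φ₁ ν : ℂ))
    (v := fun ν : ℝ => ∫ u in (-2 : ℝ)..ν,
      Complex.exp (Complex.I * ((a * u + b * u ^ 2 : ℝ) : ℂ)))
    (v' := fun u : ℝ => Complex.exp (Complex.I * ((a * u + b * u ^ 2 : ℝ) : ℂ)))
    (fun ν _ => (hφ ν).ofReal_comp) (fun ν _ => hE.integral_hasStrictDerivAt _ _ |>.hasDerivAt)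
    ((Complex.continuous_ofReal.comp hc).intervalIntegrable _ _) (hE.intervalIntegrable _ _)
  rw [oscIntegral, hparts, h0, h1]
  simp only [Complex.ofReal_zero, zero_mul, sub_self, zero_sub, norm_neg]
  refine (intervalIntegral.norm_integral_le_of_norm_le_const
    (C := B * (4 / √b)) fun ν hν => ?_).trans ?_
  · rw [uIoc_of_le (by norm_num)] at hν
    have h := hB ν ⟨hν.1.le, hν.2⟩
    rw [norm_mul, Complex.norm_real]
    exact mul_le_mul h (norm_integral_cexp_quadratic_le a hb _ _) (norm_nonneg _)
      ((abs_nonneg _).trans h)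
  · rw [abs_of_pos (by norm_num)]
    apply le_of_eq
    ring

lemma norm_oscIntegral_le_div_sqrt {φ φ₁ : ℝ → ℝ} {B : ℝ}
    (hφ : ∀ ν, HasDerivAt φ (φ₁ ν) ν) (hc : Continuous φ₁)
    (hB : ∀ ν ∈ Icc (-2 : ℝ) 2, |φ₁ ν| ≤ B) (h0 : φ (-2) = 0) (h1 : φ 2 = 0)
    (a : ℝ) {b : ℝ} (hb : b ≠ 0) : ‖oscIntegral φ a b‖ ≤ 16 * B / √|b| := by
  rcases hb.lt_or_gt with h | h
  · rw [← norm_oscIntegral_neg, abs_of_neg h]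
    exact norm_oscIntegral_le_div_sqrt_of_pos hφ hc hB h0 h1 _ (by linarith)
  · rw [abs_of_pos h]
    exact norm_oscIntegral_le_div_sqrt_of_pos hφ hc hB h0 h1 _ h

lemma norm_oscIntegral_le_div_sq {φ φ₁ φ₂ : ℝ → ℝ} {B : ℝ}
    (hφ : ∀ ν, HasDerivAt φ (φ₁ ν) ν) (hφ₁ : ∀ ν, HasDerivAt φ₁ (φ₂ ν) ν) (hc : Continuous φ₂)
    (hB : ∀ ν ∈ Icc (-2 : ℝ) 2, |φ ν| ≤ B) (hB₁ : ∀ ν ∈ Icc (-2 : ℝ) 2, |φ₁ ν| ≤ B)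
    (hB₂ : ∀ ν ∈ Icc (-2 : ℝ) 2, |φ₂ ν| ≤ B)
    (h0 : φ (-2) = 0) (h1 : φ 2 = 0) (h2 : φ₁ (-2) = 0) (h3 : φ₁ 2 = 0)
    {a b : ℝ} (ha : a ≠ 0) (hab : |b| ≤ |a| / 8) : ‖oscIntegral φ a b‖ ≤ 52 * B / a ^ 2 := by
  have hapos : 0 < |a| := abs_pos.2 ha
  have hlow : ∀ ν ∈ Icc (-2 : ℝ) 2, |a| / 2 ≤ |a + 2 * b * ν| := by
    intro ν hν
    have h4 : |2 * b * ν| ≤ |a| / 2 := by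
      rw [abs_mul, abs_mul, abs_two]
      have : |ν| ≤ 2 := abs_le.2 hν
      nlinarith [abs_nonneg b, abs_nonneg ν]
    have := abs_sub_abs_le_abs_sub a (-(2 * b * ν))
    rw [abs_neg, sub_neg_eq_add] at this
    linarith
  have hne : ∀ ν ∈ Icc (-2 : ℝ) 2, a + 2 * b * ν ≠ 0 := fun ν hν =>
    abs_pos.1 (lt_of_lt_of_le (by positivity) (hlow ν hν))
  have hlin : ∀ ν, HasDerivAt (fun u : ℝ => a + 2 * b * u) (2 * b) ν := fun ν => by
    simpa using ((hasDerivAt_id ν).const_mul (2 * b)).const_add a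
  set h' : ℝ → ℝ := fun ν => φ₁ ν / (a + 2 * b * ν) - 2 * b * φ ν / (a + 2 * b * ν) ^ 2 with hh'
  set g : ℝ → ℝ := fun ν => φ₁ ν / (a + 2 * b * ν) ^ 2 - 2 * b * φ ν / (a + 2 * b * ν) ^ 3 with hg
  set g' : ℝ → ℝ := fun ν => φ₂ ν / (a + 2 * b * ν) ^ 2 - 6 * b * φ₁ ν / (a + 2 * b * ν) ^ 3
    + 12 * b ^ 2 * φ ν / (a + 2 * b * ν) ^ 4 with hg'
  have dh : ∀ ν ∈ Icc (-2 : ℝ) 2, HasDerivAt (fun u => φ u / (a + 2 * b * u)) (h' ν) ν := by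
    intro ν hν
    have := hne ν hν
    refine ((hφ ν).div (hlin ν) this).congr_deriv ?_
    simp only [hh']
    field_simp
  have dg : ∀ ν ∈ Icc (-2 : ℝ) 2, HasDerivAt g (g' ν) ν := by
    intro ν hν
    have := hne ν hν
    refine (((hφ₁ ν).div ((hlin ν).fun_pow 2) (pow_ne_zero 2 this)).sub
      (((hφ ν).const_mul (2 * b)).div ((hlin ν).fun_pow 3) (pow_ne_zero 3 this))).congr_deriv ?_
    simp only [hg']
    field_simp
    push_cast
    ring
  have hφc : Continuous φ := continuous_iff_continuousAt.2 fun ν => (hφ ν).continuousAt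
  have hφ₁c : Continuous φ₁ := continuous_iff_continuousAt.2 fun ν => (hφ₁ ν).continuousAt
  have hE : Continuous fun u : ℝ => Complex.exp (Complex.I * ((a * u + b * u ^ 2 : ℝ) : ℂ)) := by
    fun_prop
  have hI : uIcc (-2 : ℝ) 2 = Icc (-2) 2 := uIcc_of_le (by norm_num)
  have hg'c : ContinuousOn g' (Icc (-2) 2) := by
    refine ((hc.continuousOn.div (by fun_prop) ?_).sub
      (ContinuousOn.div (by fun_prop) (by fun_prop) ?_)).add
      (ContinuousOn.div (by fun_prop) (by fun_prop) ?_)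
    all_goals exact fun ν hν => pow_ne_zero _ (hne ν hν)
  have hd : ∀ ν ∈ uIcc (-2 : ℝ) 2, HasDerivAt
      (fun u : ℝ => Complex.exp (Complex.I * ((a * u + b * u ^ 2 : ℝ) : ℂ)) *
        (((φ u / (a + 2 * b * u) : ℝ) : ℂ) + Complex.I * (g u : ℂ)))
      (Complex.I * ((φ ν : ℂ) * Complex.exp (Complex.I * ((a * ν + b * ν ^ 2 : ℝ) : ℂ))) +
        Complex.I * ((g' ν : ℂ) * Complex.exp (Complex.I * ((a * ν + b * ν ^ 2 : ℝ) : ℂ)))) ν := by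
    intro ν hν
    rw [hI] at hν
    have hn := hne ν hν
    have e1 : (φ ν : ℂ) = ((a + 2 * b * ν : ℝ) : ℂ) * ((φ ν / (a + 2 * b * ν) : ℝ) : ℂ) := by
      rw [← Complex.ofReal_mul, mul_div_cancel₀ _ hn]
    have e2 : h' ν = (a + 2 * b * ν) * g ν := by simp only [hh', hg]; field_simp
    refine ((hasDerivAt_cexp_quadratic a b ν).mul
      ((dh ν hν).ofReal_comp.fun_add ((dg ν hν).ofReal_comp.const_mul Complex.I))).congr_deriv ?_
    rw [e2]
    generalize Complex.exp _ = e
    simp only [Complex.ofReal_mul]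
    linear_combination (e * ((a + 2 * b * ν : ℝ) : ℂ) * (g ν : ℂ)) * Complex.I_sq - e * Complex.I * e1
  have hi1 : IntervalIntegrable (fun ν : ℝ =>
      (φ ν : ℂ) * Complex.exp (Complex.I * ((a * ν + b * ν ^ 2 : ℝ) : ℂ))) volume (-2) 2 :=
    ((Complex.continuous_ofReal.comp hφc).mul hE).intervalIntegrable _ _
  have hi2 : IntervalIntegrable (fun ν : ℝ =>
      (g' ν : ℂ) * Complex.exp (Complex.I * ((a * ν + b * ν ^ 2 : ℝ) : ℂ))) volume (-2) 2 :=
    ContinuousOn.intervalIntegrable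
      (hI ▸ (Complex.continuous_ofReal.comp_continuousOn hg'c).mul hE.continuousOn)
  have hftc := intervalIntegral.integral_eq_sub_of_hasDerivAt hd
    ((hi1.const_mul _).add (hi2.const_mul _))
  rw [intervalIntegral.integral_add (hi1.const_mul _) (hi2.const_mul _),
    intervalIntegral.integral_const_mul, intervalIntegral.integral_const_mul] at hftc
  simp only [hg, h0, h1, h2, h3, zero_div, mul_zero, sub_self, Complex.ofReal_zero, add_zero,
    ← mul_add] at hftc
  have hosc := (mul_eq_zero.1 hftc).resolve_left Complex.I_ne_zero
  rw [oscIntegral, eq_neg_of_add_eq_zero_left hosc, norm_neg]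
  refine (intervalIntegral.norm_integral_le_of_norm_le_const
    (C := 13 * B / a ^ 2) fun ν hν => ?_).trans ?_
  · rw [uIoc_of_le (by norm_num)] at hν
    have hν' : ν ∈ Icc (-2 : ℝ) 2 := ⟨hν.1.le, hν.2⟩
    rw [norm_mul, Complex.norm_exp_I_mul_ofReal, mul_one, Complex.norm_real, Real.norm_eq_abs]
    have hl := hlow ν hν'
    have hB0 : 0 ≤ B := (abs_nonneg _).trans (hB ν hν')
    have t1 : |φ₂ ν / (a + 2 * b * ν) ^ 2| ≤ B / (|a| / 2) ^ 2 := by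
      rw [abs_div, abs_pow]
      gcongr
      exact hB₂ ν hν'
    have t2 : |6 * b * φ₁ ν / (a + 2 * b * ν) ^ 3| ≤ 6 * (|a| / 8) * B / (|a| / 2) ^ 3 := by
      rw [abs_div, abs_pow, abs_mul, abs_mul, abs_of_pos (by norm_num : (0 : ℝ) < 6)]
      gcongr
      exact hB₁ ν hν'
    have t3 : |12 * b ^ 2 * φ ν / (a + 2 * b * ν) ^ 4| ≤
        12 * (|a| / 8) ^ 2 * B / (|a| / 2) ^ 4 := by
      rw [abs_div, abs_pow, abs_mul, abs_mul, abs_of_pos (by norm_num : (0 : ℝ) < 12), abs_pow]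
      gcongr
      exact hB ν hν'
    refine (abs_add_le _ _).trans ((add_le_add ((abs_sub _ _).trans (add_le_add t1 t2)) t3).trans ?_)
    rw [← sq_abs a]
    apply le_of_eq
    field_simp
    ring
  · rw [abs_of_pos (by norm_num)]
    apply le_of_eq
    ring

lemma norm_oscIntegral_le_div_sqrt_left {φ φ₁ φ₂ : ℝ → ℝ} {B : ℝ}
    (hφ : ∀ ν, HasDerivAt φ (φ₁ ν) ν) (hφ₁ : ∀ ν, HasDerivAt φ₁ (φ₂ ν) ν) (hc : Continuous φ₂)
    (hB : ∀ ν ∈ Icc (-2 : ℝ) 2, |φ ν| ≤ B) (hB₁ : ∀ ν ∈ Icc (-2 : ℝ) 2, |φ₁ ν| ≤ B)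
    (hB₂ : ∀ ν ∈ Icc (-2 : ℝ) 2, |φ₂ ν| ≤ B)
    (h0 : φ (-2) = 0) (h1 : φ 2 = 0) (h2 : φ₁ (-2) = 0) (h3 : φ₁ 2 = 0)
    {a : ℝ} (b : ℝ) (ha : a ≠ 0) : ‖oscIntegral φ a b‖ ≤ 52 * B / √|a| := by
  have hapos : 0 < |a| := abs_pos.2 ha
  have hs : 0 < √|a| := sqrt_pos.2 hapos
  have hB0 : 0 ≤ B := (abs_nonneg _).trans (hB 0 (by norm_num))
  have hφ₁c : Continuous φ₁ := continuous_iff_continuousAt.2 fun ν => (hφ₁ ν).continuousAt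
  rcases le_or_gt |b| (|a| / 8) with hab | hab
  · rcases le_total |a| 1 with h | h
    · refine (norm_oscIntegral_le hB a b).trans ?_
      rw [le_div_iff₀ hs]
      have : √|a| ≤ 1 := sqrt_le_one.2 h
      nlinarith
    · refine (norm_oscIntegral_le_div_sq hφ hφ₁ hc hB hB₁ hB₂ h0 h1 h2 h3 ha hab).trans ?_
      rw [← sq_abs]
      have : √|a| ≤ |a| ^ 2 := sqrt_le_iff.2 ⟨by positivity, by
        rw [← pow_mul]; exact le_self_pow₀ h (by norm_num)⟩
      gcongr
  · have hbpos : 0 < |b| := lt_of_le_of_lt (by positivity) hab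
    refine (norm_oscIntegral_le_div_sqrt hφ hφ₁c hB₁ h0 h1 a (abs_pos.1 hbpos)).trans ?_
    have h4 : √|a| ≤ 3 * √|b| := by
      rw [sqrt_le_iff]
      refine ⟨by positivity, ?_⟩
      rw [mul_pow, sq_sqrt hbpos.le]
      linarith
    rw [div_le_div_iff₀ (sqrt_pos.2 hbpos) hs]
    nlinarith [mul_nonneg hB0 (sqrt_nonneg |b|), mul_le_mul_of_nonneg_left h4 hB0]

/-- An integrable weight on the line: `|z|^{-1/2}` near the origin, `z^{-2}` away from it. -/
def decayWeight (z : ℝ) : ℝ := if |z| ≤ 1 then |z| ^ (-(1 / 2) : ℝ) else |z| ^ (-2 : ℝ)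

lemma decayWeight_nonneg (z : ℝ) : 0 ≤ decayWeight z := by
  unfold decayWeight
  split_ifs <;> positivity

lemma integrable_decayWeight : Integrable decayWeight := by
  refine (integrable_fun_norm_addHaar (E := ℝ) volume
    (f := fun r : ℝ => if r ≤ 1 then r ^ (-(1 / 2) : ℝ) else r ^ (-2 : ℝ))).2 ?_
  simp only [Module.finrank_self, Nat.sub_self, pow_zero, one_smul]
  rw [← Ioc_union_Ioi_eq_Ioi zero_le_one]
  refine IntegrableOn.union ?_ ?_
  · have := (intervalIntegrable_iff_integrableOn_Ioc_of_le zero_le_one).1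
      (intervalIntegral.intervalIntegrable_rpow' (a := 0) (b := 1) (r := -(1 / 2)) (by norm_num))
    refine this.congr_fun (fun x hx => ?_) measurableSet_Ioc
    simp only [if_pos hx.2]
  · have := integrableOn_Ioi_rpow_of_lt (a := -2) (c := 1) (by norm_num) one_pos
    refine this.congr_fun (fun x hx => ?_) measurableSet_Ioi
    simp only [if_neg (not_le.2 (mem_Ioi.1 hx))]

lemma norm_oscIntegral_le_decayWeight {φ φ₁ φ₂ : ℝ → ℝ} {B : ℝ}
    (hφ : ∀ ν, HasDerivAt φ (φ₁ ν) ν) (hφ₁ : ∀ ν, HasDerivAt φ₁ (φ₂ ν) ν) (hc : Continuous φ₂)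
    (hB : ∀ ν ∈ Icc (-2 : ℝ) 2, |φ ν| ≤ B) (hB₁ : ∀ ν ∈ Icc (-2 : ℝ) 2, |φ₁ ν| ≤ B)
    (hB₂ : ∀ ν ∈ Icc (-2 : ℝ) 2, |φ₂ ν| ≤ B)
    (h0 : φ (-2) = 0) (h1 : φ 2 = 0) (h2 : φ₁ (-2) = 0) (h3 : φ₁ 2 = 0)
    {a b S : ℝ} (ha : a ≠ 0) (hS : 1 ≤ S) (hbS : |b| ≤ S / 8) :
    ‖oscIntegral φ a b‖ ≤ 52 * B / √S * decayWeight (a / S) := by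
  have hB0 : 0 ≤ B := (abs_nonneg _).trans (hB 0 (by norm_num))
  have hS0 : 0 < S := by linarith
  have hapos : 0 < |a| := abs_pos.2 ha
  have habs : |a / S| = |a| / S := by rw [abs_div, abs_of_pos hS0]
  rw [decayWeight, habs]
  split_ifs with h
  · refine (norm_oscIntegral_le_div_sqrt_left hφ hφ₁ hc hB hB₁ hB₂ h0 h1 h2 h3 b ha).trans ?_
    rw [rpow_neg (by positivity), ← sqrt_eq_rpow, sqrt_div hapos.le]
    have := sqrt_pos.2 hapos
    have := sqrt_pos.2 hS0
    apply le_of_eq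
    field_simp
  · rw [not_le, lt_div_iff₀ hS0, one_mul] at h
    refine (norm_oscIntegral_le_div_sq hφ hφ₁ hc hB hB₁ hB₂ h0 h1 h2 h3 ha (by linarith)).trans ?_
    have h5 : √S ≤ S ^ 2 := sqrt_le_iff.2 ⟨by positivity, by
      rw [← pow_mul]; exact le_self_pow₀ hS (by norm_num)⟩
    have := sqrt_pos.2 hS0
    rw [rpow_neg (by positivity), rpow_two, div_pow, sq_abs, inv_div, div_mul_div_comm,
      div_le_div_iff₀ (by positivity) (by positivity)]
    have : 52 * B * (√S * a ^ 2) ≤ 52 * B * (S ^ 2 * a ^ 2) := by gcongr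
    linarith

lemma chiI_eq_sub (μ₀ : ℝ → ℝ) (k : ℤ) (ξ : ℝ) :
    chiI μ₀ (k - 1) (k + 1) ξ = μ₀ (ξ / (2 * 2 ^ k)) - μ₀ (ξ / (2 ^ k / 4)) := by
  have hI : Finset.Icc (k - 1) (k + 1) = {k - 1, k, k + 1} := by
    ext m
    simp only [Finset.mem_Icc, Finset.mem_insert, Finset.mem_singleton]
    omega
  have e1 : (2 : ℝ) ^ (k + 1) = 2 * 2 ^ k := by rw [zpow_add₀ two_ne_zero, zpow_one, mul_comm]
  have e2 : (2 : ℝ) ^ (k - 1 - 1) = 2 ^ k / 4 := by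
    rw [sub_sub, zpow_sub₀ two_ne_zero]
    norm_num
  rw [chiI, hI, Finset.sum_insert (by simp; omega), Finset.sum_insert (by simp),
    Finset.sum_singleton]
  simp only [chi, add_sub_cancel_right]
  rw [e1, e2]
  ring

lemma eq_zero_of_support_subset {μ₀ : ℝ → ℝ}
    (hsupp : Function.support μ₀ ⊆ Icc (-8/5 : ℝ) (8/5)) {s : ℝ} (hs : 8 / 5 < |s|) :
    μ₀ s = 0 := by
  by_contra h
  have := hsupp h
  exact absurd (abs_le.2 ⟨by linarith [this.1], this.2⟩) (not_le.2 hs)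

lemma chiI_eq_zero {μ₀ : ℝ → ℝ} (hsupp : Function.support μ₀ ⊆ Icc (-8/5 : ℝ) (8/5))
    (hone : ∀ s ∈ Icc (-5/4 : ℝ) (5/4 : ℝ), μ₀ s = 1) {k : ℤ} {ξ : ℝ}
    (hξ : ¬ ((2 : ℝ) ^ k / 4 ≤ |ξ| ∧ |ξ| ≤ 4 * 2 ^ k)) :
    chiI μ₀ (k - 1) (k + 1) ξ = 0 := by
  have hK : (0 : ℝ) < 2 ^ k := by positivity
  rw [chiI_eq_sub]
  have habs : ∀ r : ℝ, 0 < r → |ξ / r| = |ξ| / r := fun r hr => by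
    rw [abs_div, abs_of_pos hr]
  rcases lt_or_ge |ξ| ((2 : ℝ) ^ k / 4) with h | h
  · have one_of : ∀ r : ℝ, (2 : ℝ) ^ k / 4 ≤ r → μ₀ (ξ / r) = 1 := by
      intro r hr
      have hr0 : 0 < r := by linarith
      have : |ξ / r| ≤ 5 / 4 := by
        rw [habs r hr0, div_le_iff₀ hr0]
        linarith
      exact hone _ ⟨by linarith [(abs_le.1 this).1], (abs_le.1 this).2⟩
    rw [one_of _ (by linarith), one_of _ le_rfl, sub_self]
  · have h' : 4 * (2 : ℝ) ^ k < |ξ| := by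
      by_contra h''
      exact hξ ⟨h, not_lt.1 h''⟩
    have zero_of : ∀ r : ℝ, 0 < r → r ≤ 2 * 2 ^ k → μ₀ (ξ / r) = 0 := by
      intro r hr0 hr
      refine eq_zero_of_support_subset hsupp ?_
      rw [habs r hr0, lt_div_iff₀ hr0]
      linarith
    rw [zero_of _ (by linarith) le_rfl, zero_of _ (by linarith) (by linarith), sub_self]

lemma chiI_sq_le_one {μ₀ : ℝ → ℝ} (hrange : ∀ s, μ₀ s ∈ Icc (0:ℝ) 1) (k : ℤ) (ξ : ℝ) :
    chiI μ₀ (k - 1) (k + 1) ξ ^ 2 ≤ 1 := by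
  rw [chiI_eq_sub, sq_le_one_iff_abs_le_one, abs_le]
  have h1 := hrange (ξ / (2 * 2 ^ k))
  have h2 := hrange (ξ / (2 ^ k / 4))
  exact ⟨by linarith [h1.1, h2.2], by linarith [h1.2, h2.1]⟩

lemma integral_slice_eq {μ₀ : ℝ → ℝ} (hsupp : Function.support μ₀ ⊆ Icc (-8/5 : ℝ) (8/5))
    {L : ℝ} (hL : 0 < L) (c x y t ξ : ℝ) :
    ∫ μ : ℝ, ((c * μ₀ (μ / L) ^ 2 : ℝ) : ℂ) *
        Complex.exp (Complex.I * ((x * ξ + y * μ + t * disp ξ μ : ℝ) : ℂ)) =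
      L * ((c : ℂ) * Complex.exp (Complex.I * ((x * ξ + t * ξ ^ 3 : ℝ) : ℂ)) *
        oscIntegral (fun s => μ₀ s ^ 2) (L * y) (t * L ^ 2 / ξ)) := by
  have hscale := Measure.integral_comp_div (fun ν : ℝ =>
    ((c : ℂ) * Complex.exp (Complex.I * ((x * ξ + t * ξ ^ 3 : ℝ) : ℂ))) *
      (((μ₀ ν ^ 2 : ℝ) : ℂ) *
        Complex.exp (Complex.I * ((L * y * ν + t * L ^ 2 / ξ * ν ^ 2 : ℝ) : ℂ)))) L
  rw [abs_of_pos hL, Complex.real_smul] at hscale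
  rw [oscIntegral, intervalIntegral.integral_eq_integral_of_support_subset,
    ← integral_const_mul, ← hscale]
  · refine integral_congr_ae (Filter.Eventually.of_forall fun μ => ?_)
    have hphase : x * ξ + y * μ + t * disp ξ μ =
        (x * ξ + t * ξ ^ 3) + (L * y * (μ / L) + t * L ^ 2 / ξ * (μ / L) ^ 2) := by
      obtain ⟨ν, rfl⟩ : ∃ ν, μ = L * ν := ⟨μ / L, (mul_div_cancel₀ μ hL.ne').symm⟩
      rw [disp, mul_div_cancel_left₀ ν hL.ne']
      ring
    simp only [hphase]
    rw [Complex.ofReal_add (x * ξ + t * ξ ^ 3), mul_add, Complex.exp_add, Complex.ofReal_mul]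
    ring
  · intro ν hν
    by_contra hout
    refine hν ?_
    have h85 : 8 / 5 < |ν| := by
      by_contra h
      have := abs_le.1 (not_lt.1 h)
      exact hout ⟨by linarith [this.1], by linarith [this.2]⟩
    simp [eq_zero_of_support_subset hsupp h85]

/-- Fubini, as an upper bound: no integrability of the integrand is needed. -/
lemma norm_integral_prod_le {f : ℝ × ℝ → ℂ} {g : ℝ → ℝ} (hg : Integrable g)
    (h : ∀ ξ, ‖∫ μ, f (ξ, μ)‖ ≤ g ξ) : ‖∫ q, f q‖ ≤ ∫ ξ, g ξ := by
  by_cases hf : Integrable f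
  · rw [Measure.volume_eq_prod] at hf ⊢
    rw [integral_prod f hf]
    exact norm_integral_le_of_norm_le hg (Filter.Eventually.of_forall h)
  · rw [integral_undef hf, norm_zero]
    exact integral_nonneg fun ξ => (norm_nonneg _).trans (h ξ)

lemma exists_oscIntegral_sq_bound {μ₀ : ℝ → ℝ} (hsmooth : ContDiff ℝ (⊤ : ℕ∞) μ₀)
    (hsupp : Function.support μ₀ ⊆ Icc (-8/5 : ℝ) (8/5)) :
    ∃ B : ℝ, 0 < B ∧ ∀ a b S : ℝ, a ≠ 0 → 1 ≤ S → |b| ≤ S / 8 →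
      ‖oscIntegral (fun s => μ₀ s ^ 2) a b‖ ≤ B / √S * decayWeight (a / S) := by
  have h2 : μ₀ 2 = 0 := eq_zero_of_support_subset hsupp (by norm_num)
  have hm2 : μ₀ (-2) = 0 := eq_zero_of_support_subset hsupp (by norm_num)
  set φ : ℝ → ℝ := fun s => μ₀ s ^ 2 with hφdef
  have hs : ContDiff ℝ (⊤ : ℕ∞) φ := hsmooth.pow 2
  have hs1 : ContDiff ℝ (⊤ : ℕ∞) (deriv φ) := (contDiff_infty_iff_deriv.1 hs).2
  have hs2 : ContDiff ℝ (⊤ : ℕ∞) (deriv (deriv φ)) := (contDiff_infty_iff_deriv.1 hs1).2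
  have hφ : ∀ ν, HasDerivAt φ (deriv φ ν) ν := fun ν =>
    ((hs.differentiable (by simp)) ν).hasDerivAt
  have hφ₁ : ∀ ν, HasDerivAt (deriv φ) (deriv (deriv φ) ν) ν := fun ν =>
    ((hs1.differentiable (by simp)) ν).hasDerivAt
  have hderiv : ∀ ν, deriv φ ν = 2 * μ₀ ν * deriv μ₀ ν := fun ν => by
    simpa using (((hsmooth.differentiable (by simp)) ν).hasDerivAt.fun_pow 2).deriv
  obtain ⟨B₀, h₀⟩ := (isCompact_Icc (a := (-2 : ℝ)) (b := 2)).exists_bound_of_continuousOn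
    hs.continuous.continuousOn
  obtain ⟨B₁, h₁⟩ := (isCompact_Icc (a := (-2 : ℝ)) (b := 2)).exists_bound_of_continuousOn
    hs1.continuous.continuousOn
  obtain ⟨B₂, h₂⟩ := (isCompact_Icc (a := (-2 : ℝ)) (b := 2)).exists_bound_of_continuousOn
    hs2.continuous.continuousOn
  simp only [Real.norm_eq_abs] at h₀ h₁ h₂
  set B : ℝ := max 1 (max B₀ (max B₁ B₂)) with hB
  have hB1 : 1 ≤ B := le_max_left _ _
  refine ⟨52 * B, by positivity, fun a b S ha hS hbS => ?_⟩
  exact norm_oscIntegral_le_decayWeight hφ hφ₁ hs2.continuous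
    (fun ν hν => (h₀ ν hν).trans (by simp [hB]))
    (fun ν hν => (h₁ ν hν).trans (by simp [hB]))
    (fun ν hν => (h₂ ν hν).trans (by simp [hB]))
    (by simp [hφdef, hm2]) (by simp [hφdef, h2]) (by simp [hderiv, hm2]) (by simp [hderiv, h2])
    ha hS hbS

/-- The pointwise kernel bound, uniform in `x` and `|t| ≤ 1`. -/
lemma norm_kernel_le {μ₀ : ℝ → ℝ} (hrange : ∀ s, μ₀ s ∈ Icc (0:ℝ) 1)
    (hsupp : Function.support μ₀ ⊆ Icc (-8/5 : ℝ) (8/5))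
    (hone : ∀ s ∈ Icc (-5/4 : ℝ) (5/4 : ℝ), μ₀ s = 1) {B : ℝ} (hB0 : 0 < B)
    (hB : ∀ a b S : ℝ, a ≠ 0 → 1 ≤ S → |b| ≤ S / 8 →
      ‖oscIntegral (fun s => μ₀ s ^ 2) a b‖ ≤ B / √S * decayWeight (a / S))
    {k : ℤ} (hk : k ≤ 0) {L : ℝ} (hL : 1 ≤ L) (x : ℝ) {y t : ℝ} (hy : y ≠ 0) (ht : |t| ≤ 1) :
    ‖∫ q : ℝ × ℝ, (((chiI μ₀ (k - 1) (k + 1) q.1) ^ 2 * (μ₀ (q.2 / L)) ^ 2 : ℝ) : ℂ) *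
        Complex.exp (Complex.I * ((x * q.1 + y * q.2 + t * disp q.1 q.2 : ℝ) : ℂ))‖ ≤
      8 * B * (2 ^ k * √(2 ^ k)) * decayWeight (y / (32 * L / 2 ^ k)) := by
  set K : ℝ := 2 ^ k
  have hK : 0 < K := by positivity
  have hK1 : K ≤ 1 := zpow_le_one_of_nonpos₀ one_le_two hk
  have hL0 : 0 < L := by linarith
  set M : ℝ := B * √K * decayWeight (y / (32 * L / K)) with hM
  have hM0 : 0 ≤ M := mul_nonneg (by positivity) (decayWeight_nonneg _)
  have hg : Integrable ((Icc (-(4 * K)) (4 * K)).indicator fun _ => M) :=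
    (integrable_indicator_iff measurableSet_Icc).2 (by simp)
  have hgint : ∫ ξ, (Icc (-(4 * K)) (4 * K)).indicator (fun _ => M) ξ = 8 * K * M := by
    rw [integral_indicator measurableSet_Icc, setIntegral_const, smul_eq_mul,
      Real.volume_real_Icc_of_le (by linarith)]
    ring
  refine (norm_integral_prod_le hg fun ξ => ?_).trans (le_of_eq ?_)
  · dsimp only
    rw [integral_slice_eq hsupp hL0]
    by_cases hξ : K / 4 ≤ |ξ| ∧ |ξ| ≤ 4 * K
    · rw [indicator_of_mem (show ξ ∈ Icc (-(4 * K)) (4 * K) from abs_le.1 hξ.2)]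
      have hξ0 : 0 < |ξ| := by linarith [hξ.1]
      set S : ℝ := 32 * L ^ 2 / K with hS
      have hS1 : 1 ≤ S := by
        rw [hS, le_div_iff₀ hK]
        nlinarith
      have hb : |t * L ^ 2 / ξ| ≤ S / 8 := by
        rw [abs_div, abs_mul, abs_of_pos (by positivity : 0 < L ^ 2), div_le_iff₀ hξ0, hS]
        have : 32 * L ^ 2 / K / 8 * (K / 4) = L ^ 2 := by field_simp; norm_num
        have h3 : 32 * L ^ 2 / K / 8 * (K / 4) ≤ 32 * L ^ 2 / K / 8 * |ξ| := by
          gcongr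
          exact hξ.1
        nlinarith [sq_nonneg L]
      have hosc := hB (L * y) _ S (mul_ne_zero hL0.ne' hy) hS1 hb
      have harg : L * y / S = y / (32 * L / K) := by
        rw [hS]
        field_simp
      have hc : |chiI μ₀ (k - 1) (k + 1) ξ ^ 2| ≤ 1 := by
        rw [abs_of_nonneg (sq_nonneg _)]
        exact chiI_sq_le_one hrange k ξ
      have hroot : L / √K ≤ √S := by
        rw [← sqrt_sq hL0.le, ← sqrt_div (sq_nonneg L), hS]
        apply sqrt_le_sqrt
        gcongr
        nlinarith [sq_nonneg L]
      have hcoef : L * (B / √S) ≤ B * √K := by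
        have hsK : 0 < √K := sqrt_pos.2 hK
        rw [← mul_div_assoc, div_le_iff₀ (sqrt_pos.2 (by linarith))]
        rw [div_le_iff₀ hsK] at hroot
        nlinarith
      rw [norm_mul, norm_mul, norm_mul, Complex.norm_exp_I_mul_ofReal, mul_one,
        Complex.norm_real, Complex.norm_real, Real.norm_of_nonneg hL0.le, Real.norm_eq_abs]
      rw [harg] at hosc
      calc L * (|chiI μ₀ (k - 1) (k + 1) ξ ^ 2| * _)
          ≤ L * (1 * (B / √S * decayWeight (y / (32 * L / K)))) := by gcongr
        _ = L * (B / √S) * decayWeight (y / (32 * L / K)) := by ring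
        _ ≤ M := mul_le_mul_of_nonneg_right hcoef (decayWeight_nonneg _)
    · rw [chiI_eq_zero hsupp hone hξ]
      simp only [ne_eq, OfNat.ofNat_ne_zero, not_false_eq_true, zero_pow, Complex.ofReal_zero,
        zero_mul, mul_zero, norm_zero]
      exact indicator_nonneg (fun _ _ => hM0) ξ
  · rw [hgint, hM]
    ring

theorem kernel_maximal_L1_bound_low_freq (μ₀ : ℝ → ℝ)
    (hsmooth : ContDiff ℝ (⊤ : ℕ∞) μ₀) (hrange : ∀ s, μ₀ s ∈ Icc (0:ℝ) 1)
    (hsupp : Function.support μ₀ ⊆ Icc (-8/5 : ℝ) (8/5))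
    (hone : ∀ s ∈ Icc (-5/4 : ℝ) (5/4 : ℝ), μ₀ s = 1)
    (heven : ∀ s, μ₀ (-s) = μ₀ s) :
    ∃ C : ℝ, 0 < C ∧ ∀ k l : ℤ, k ≤ 0 → 0 ≤ l →
      ∫ y : ℝ,
        ⨆ (x : ℝ) (t : ℝ) (_ : |t| ≤ 1),
          ‖∫ q : ℝ × ℝ,
            (((chiI μ₀ (k - 1) (k + 1) q.1) ^ 2 * (μ₀ (q.2 / 2 ^ l)) ^ 2 : ℝ) : ℂ) *
              Complex.exp (Complex.I * ((x * q.1 + y * q.2 + t * disp q.1 q.2 : ℝ) : ℂ))‖ ≤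
        C * (2:ℝ) ^ (((2*l + k : ℤ) : ℝ) / 2) := by
  obtain ⟨B, hB0, hB⟩ := exists_oscIntegral_sq_bound hsmooth hsupp
  set W : ℝ := ∫ z, decayWeight z with hW
  have hW0 : 0 ≤ W := integral_nonneg decayWeight_nonneg
  refine ⟨256 * B * (W + 1), by positivity, fun k l hk hl => ?_⟩
  have hK : (0 : ℝ) < 2 ^ k := by positivity
  have hL : (1 : ℝ) ≤ 2 ^ l := one_le_zpow₀ one_le_two hl
  have hR : (0 : ℝ) < 32 * 2 ^ l / 2 ^ k := by positivity
  have hpow : (2 : ℝ) ^ (((2 * l + k : ℤ) : ℝ) / 2) = 2 ^ l * √(2 ^ k) := by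
    rw [sqrt_eq_rpow, ← rpow_intCast, ← rpow_intCast, ← rpow_mul zero_le_two,
      ← rpow_add two_pos]
    congr 1
    push_cast
    ring
  calc _ ≤ ∫ y : ℝ, 8 * B * (2 ^ k * √(2 ^ k)) * decayWeight (y / (32 * 2 ^ l / 2 ^ k)) := by
        refine integral_mono_of_nonneg (Filter.Eventually.of_forall fun y => ?_)
          ((integrable_decayWeight.comp_div hR.ne').const_mul _) ?_
        · exact Real.iSup_nonneg fun x => Real.iSup_nonneg fun t => Real.iSup_nonneg fun _ =>
            norm_nonneg _
        · filter_upwards [compl_mem_ae_iff.2 (measure_singleton (0 : ℝ))] with y hy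
          have hbd : 0 ≤ 8 * B * (2 ^ k * √(2 ^ k)) * decayWeight (y / (32 * 2 ^ l / 2 ^ k)) :=
            mul_nonneg (by positivity) (decayWeight_nonneg _)
          exact Real.iSup_le (fun x => Real.iSup_le (fun t => Real.iSup_le (fun ht =>
            norm_kernel_le hrange hsupp hone hB0 hB hk hL x hy ht) hbd) hbd) hbd
    _ = 256 * B * W * (2 ^ l * √(2 ^ k)) := by
        rw [integral_const_mul, Measure.integral_comp_div, abs_of_pos hR, smul_eq_mul, ← hW]
        field_simp
        ring
    _ ≤ 256 * B * (W + 1) * (2 ^ l * √(2 ^ k)) := by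
        gcongr
        linarith
    _ = _ := by rw [hpow]
end
end
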